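/- arXiv:2408.13755 — 7 statements merged into one kernel-verified Lean document; each statement's English description precedes it below -/
import Mathlib

section
/- Let A and B be nonempty finite sets of integers with |A| = 2 and |B| ≥ 2. Then |A +̂ B| = |A| + |B| - 3 if and only if A = B. -/
/-- The restricted sumset of two finite sets of integers:
`A +̂ B = {a + b : a ∈ A, b ∈ B, a ≠ b}`. -/
def restrictedSumset (A B : Finset ℤ) : Finset ℤ :=
  ((A ×ˢ B).filter fun p => p.1 ≠ p.2).image fun p => p.1 + p.2

theorem stmt_0 (A B : Finset ℤ) (hA : A.card = 2) (hB : 2 ≤ B.card) :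
    (restrictedSumset A B).card = A.card + B.card - 3 ↔ A = B := by
  obtain ⟨a, b, hab, rfl⟩ := Finset.card_eq_two.mp hA
  constructor
  · intro h
    rw [hA] at h
    have sub : ∀ x ∈ ({a, b} : Finset ℤ),
        (B.erase x).image (fun y => x + y) ⊆ restrictedSumset {a, b} B := by
      intro x hx z hz
      obtain ⟨y, hy, rfl⟩ := Finset.mem_image.mp hz
      rw [Finset.mem_erase] at hy
      exact Finset.mem_image.mpr ⟨(x, y), Finset.mem_filter.mpr
        ⟨Finset.mem_product.mpr ⟨hx, hy.2⟩, fun e => hy.1 e.symm⟩, rfl⟩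
    have inj : ∀ x : ℤ, Function.Injective (fun y => x + y) := fun x => add_right_injective x
    have mem : ∀ x ∈ ({a, b} : Finset ℤ), x ∈ B := by
      intro x hx
      by_contra hxB
      have h1 := Finset.card_le_card (sub x hx)
      rw [Finset.card_image_of_injective _ (inj x), Finset.erase_eq_of_notMem hxB] at h1
      omega
    have eq : ∀ x ∈ ({a, b} : Finset ℤ),
        (B.erase x).image (fun y => x + y) = restrictedSumset {a, b} B := by
      intro x hx
      apply Finset.eq_of_subset_of_card_le (sub x hx)
      rw [Finset.card_image_of_injective _ (inj x), Finset.card_erase_of_mem (mem x hx)]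
      omega
    have sm : ∀ x ∈ ({a, b} : Finset ℤ),
        ∑ z ∈ restrictedSumset {a, b} B, z = ((B.card : ℤ) - 2) * x + ∑ y ∈ B, y := by
      intro x hx
      rw [← eq x hx, Finset.sum_image (fun _ _ _ _ e => inj x e), Finset.sum_add_distrib,
        Finset.sum_const, Finset.card_erase_of_mem (mem x hx), nsmul_eq_mul,
        ← Finset.add_sum_erase B (fun y => y) (mem x hx), Nat.cast_sub (by omega)]
      push_cast
      ring
    have ha := sm a (by simp)
    have hb := sm b (by simp)
    have hz : ((B.card : ℤ) - 2) * (a - b) = 0 := by linarith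
    have hc : (B.card : ℤ) - 2 = 0 :=
      (mul_eq_zero.mp hz).resolve_right (sub_ne_zero.mpr hab)
    exact Finset.eq_of_subset_of_card_le mem (by omega)
  · intro h
    subst h
    have : restrictedSumset {a, b} {a, b} = {a + b} := by
      ext z
      simp only [restrictedSumset, Finset.mem_image, Finset.mem_filter, Finset.mem_product,
        Finset.mem_insert, Finset.mem_singleton, Prod.exists]
      constructor
      · rintro ⟨x, y, ⟨⟨rfl | rfl, rfl | rfl⟩, hne⟩, rfl⟩ <;> simp_all [add_comm]
      · rintro rfl
        exact ⟨a, b, ⟨⟨Or.inl rfl, Or.inr rfl⟩, hab⟩, rfl⟩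
    rw [this, hA]
    simp
end

section
/- Let A and B be nonempty finite sets of integers with |A| = 3 and |B| ≥ 2. Then |A +̂ B| = |A| + |B| - 3 if and only if A = B. -/
theorem rs_mem (A B : Finset ℤ) (s : ℤ) :
    s ∈ restrictedSumset A B ↔ ∃ x ∈ A, ∃ y ∈ B, x ≠ y ∧ x + y = s := by
  unfold restrictedSumset
  simp only [Finset.mem_image, Finset.mem_filter, Finset.mem_product, Prod.exists]
  constructor
  · rintro ⟨x, y, ⟨⟨h1, h2⟩, h3⟩, h4⟩
    exact ⟨x, h1, y, h2, h3, h4⟩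
  · rintro ⟨x, h1, y, h2, h3, h4⟩
    exact ⟨x, y, ⟨⟨h1, h2⟩, h3⟩, h4⟩

theorem rs_L1 (B S : Finset ℤ) (hS : S.card = B.card) (x : ℤ)
    (h : ∀ y ∈ B, x + y ∈ S) : ∀ s ∈ S, s - x ∈ B := by
  have hsub : B.image (fun y => x + y) ⊆ S := by
    intro s hs
    obtain ⟨y, hy, rfl⟩ := Finset.mem_image.1 hs
    exact h y hy
  have hc : (B.image (fun y => x + y)).card = B.card :=
    Finset.card_image_of_injective _ (add_right_injective x)
  have he := Finset.eq_of_subset_of_card_le hsub (by omega)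
  intro s hs
  rw [← he] at hs
  obtain ⟨y, hy, rfl⟩ := Finset.mem_image.1 hs
  simpa using hy

theorem rs_L2 (B S : Finset ℤ) (hS : S.card = B.card) (x t : ℤ) (hx : x ∈ B)
    (h : ∀ y ∈ B, y ≠ x → x + y ∈ S) (ht : t ∈ S) (htB : t - x ∉ B) :
    ∀ s ∈ S, s = t ∨ s - x ∈ B := by
  have h1 := rs_L1 (B.erase x) (S.erase t)
    (by rw [Finset.card_erase_of_mem hx, Finset.card_erase_of_mem ht, hS]) x
    (by
      intro y hy
      rw [Finset.mem_erase] at hy ⊢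
      refine ⟨?_, h y hy.2 hy.1⟩
      rintro rfl
      apply htB
      simpa using hy.2)
  intro s hs
  by_cases hst : s = t
  · exact Or.inl hst
  · exact Or.inr (Finset.mem_of_mem_erase (h1 s (Finset.mem_erase.2 ⟨hst, hs⟩)))

theorem rs_sorted (A : Finset ℤ) (hA : A.card = 3) :
    ∃ a b c : ℤ, a < b ∧ b < c ∧ A = {a, b, c} := by
  let f := A.orderEmbOfFin hA
  refine ⟨f 0, f 1, f 2, f.strictMono (by decide), f.strictMono (by decide), ?_⟩
  symm
  apply Finset.eq_of_subset_of_card_le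
  · intro x hx
    simp only [Finset.mem_insert, Finset.mem_singleton] at hx
    rcases hx with rfl | rfl | rfl <;> exact Finset.orderEmbOfFin_mem A hA _
  · have h1 : f 0 < f 1 := f.strictMono (by decide)
    have h2 : f 1 < f 2 := f.strictMono (by decide)
    rw [hA, Finset.card_eq_three.2 ⟨f 0, f 1, f 2, h1.ne, (h1.trans h2).ne, h2.ne, rfl⟩]

theorem stmt_1 (A B : Finset ℤ) (hA : A.card = 3) (hB : 2 ≤ B.card) :
    (restrictedSumset A B).card = A.card + B.card - 3 ↔ A = B := by
  obtain ⟨a, b, c, hab, hbc, rfl⟩ := rs_sorted A hA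
  have hmem := rs_mem {a, b, c} B
  constructor
  · intro hS
    replace hS : (restrictedSumset {a, b, c} B).card = B.card := by omega
    generalize restrictedSumset {a, b, c} B = S at hS hmem
    have Ma : ∀ y ∈ B, y ≠ a → a + y ∈ S := fun y hy hne =>
      (hmem _).2 ⟨a, by simp, y, hy, hne.symm, rfl⟩
    have Mb : ∀ y ∈ B, y ≠ b → b + y ∈ S := fun y hy hne =>
      (hmem _).2 ⟨b, by simp, y, hy, hne.symm, rfl⟩
    have Mc : ∀ y ∈ B, y ≠ c → c + y ∈ S := fun y hy hne =>
      (hmem _).2 ⟨c, by simp, y, hy, hne.symm, rfl⟩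
    have hne : B.Nonempty := Finset.card_pos.1 (by omega)
    obtain ⟨m, hm, hmin⟩ : ∃ m ∈ B, ∀ y ∈ B, m ≤ y :=
      ⟨B.min' hne, B.min'_mem hne, fun y hy => B.min'_le y hy⟩
    obtain ⟨M, hM, hmax⟩ : ∃ m ∈ B, ∀ y ∈ B, y ≤ m :=
      ⟨B.max' hne, B.max'_mem hne, fun y hy => B.le_max' y hy⟩
    have L1 := rs_L1 B S hS
    have L2 := rs_L2 B S hS
    clear hmem
    have haB : a ∈ B := by
      by_contra ha
      have h := L1 a (fun y hy => Ma y hy (by rintro rfl; exact ha hy))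
      by_cases hc : M = c
      · have := hmax _ (h _ (Mb M hM (by omega)))
        omega
      · have := hmax _ (h _ (Mc M hM hc))
        omega
    have hcB : c ∈ B := by
      by_contra ha
      have h := L1 c (fun y hy => Mc y hy (by rintro rfl; exact ha hy))
      by_cases hc : m = a
      · have := hmin _ (h _ (Mb m hm (by omega)))
        omega
      · have := hmin _ (h _ (Ma m hm hc))
        omega
    have hma := hmin a haB
    have hcM := hmax c hcB
    have hbB : b ∈ B := by
      by_contra ha
      have h := L1 b (fun y hy => Mb y hy (by rintro rfl; exact ha hy))
      have hc : M = c := by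
        by_contra hc
        have := hmax _ (h _ (Mc M hM hc))
        omega
      have ha' : m = a := by
        by_contra hc
        have := hmin _ (h _ (Ma m hm hc))
        omega
      have hac := h _ (Ma c hcB (by omega))
      have e1 := hmax _ (h _ (Mc _ hac (by omega)))
      have e2 := hmin _ (h _ (Ma _ hac (by omega)))
      have : a + c - b = b := by omega
      exact ha (this ▸ hac)
    have hlt : ∀ z, z < m → z ∉ B := fun z hz hzB => absurd (hmin z hzB) (by omega)
    have hgt : ∀ z, M < z → z ∉ B := fun z hz hzB => absurd (hmax z hzB) (by omega)
    have hMc : M = c := by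
      by_contra hc
      rcases L2 a (c + M) haB Ma (Mc M hM hc) (hgt _ (by omega)) _ (Mb M hM (by omega)) with h | h
      · omega
      · exact hgt _ (by omega) h
    have hma' : m = a := by
      by_contra hc
      rcases L2 c (a + m) hcB Mc (Ma m hm hc) (hlt _ (by omega)) _ (Mb m hm (by omega)) with h | h
      · omega
      · exact hlt _ (by omega) h
    subst hMc hma'
    ext x
    simp only [Finset.mem_insert, Finset.mem_singleton]
    constructor
    · rintro (rfl | rfl | rfl) <;> assumption
    · intro hx
      by_contra hcon
      push Not at hcon
      obtain ⟨n1, n2, n3⟩ := hcon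
      have k1 : x ≤ b := by
        by_contra hlt'
        rcases L2 m (b + M) haB Ma (Mb M hM (by omega)) (hgt _ (by omega)) _ (Mc x hx n3) with h | h
        · omega
        · exact hgt _ (by omega) h
      have k2 : b ≤ x := by
        by_contra hlt'
        rcases L2 M (b + m) hcB Mc (Mb m hm (by omega)) (hlt _ (by omega)) _ (Ma x hx n1) with h | h
        · omega
        · exact hlt _ (by omega) h
      omega
  · rintro rfl
    rw [hA]
    have : restrictedSumset {a, b, c} {a, b, c} = {a + b, a + c, b + c} := by
      ext s
      rw [hmem]
      simp only [Finset.mem_insert, Finset.mem_singleton]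
      constructor
      · rintro ⟨x, hx, y, hy, h, rfl⟩
        omega
      · rintro (rfl | rfl | rfl)
        · exact ⟨a, by simp, b, by simp, by omega, rfl⟩
        · exact ⟨a, by simp, c, by simp, by omega, rfl⟩
        · exact ⟨b, by simp, c, by simp, by omega, rfl⟩
    rw [this]
    exact Finset.card_eq_three.2 ⟨_, _, _, by omega, by omega, by omega, rfl⟩
end

section
/- Let A and B be finite sets of integers with |A| ≥ 5 and |B| ≥ 2. Then |A +̂ B| = |A| + |B| - 3 if and only if A = B and A is an arithmetic progression, i.e., there exist integers τ and d with d ≠ 0 such that A = {τ + i·d : i = 0, 1, ..., |A| - 1}. -/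
theorem mem_rs {A B : Finset ℤ} {s : ℤ} :
    s ∈ restrictedSumset A B ↔ ∃ a ∈ A, ∃ b ∈ B, a ≠ b ∧ a + b = s := by
  unfold restrictedSumset
  simp only [Finset.mem_image, Finset.mem_filter, Finset.mem_product, Prod.exists]
  constructor
  · rintro ⟨a, b, ⟨⟨ha, hb⟩, h⟩, e⟩
    exact ⟨a, ha, b, hb, h, e⟩
  · rintro ⟨a, ha, b, hb, h, e⟩
    exact ⟨a, b, ⟨⟨ha, hb⟩, h⟩, e⟩

theorem rs_comm (A B : Finset ℤ) : restrictedSumset A B = restrictedSumset B A := by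
  ext s
  simp only [mem_rs]
  constructor
  · rintro ⟨a, ha, b, hb, h, e⟩
    exact ⟨b, hb, a, ha, h.symm, by omega⟩
  · rintro ⟨a, ha, b, hb, h, e⟩
    exact ⟨b, hb, a, ha, h.symm, by omega⟩

def ng (A : Finset ℤ) : Finset ℤ := A.image (fun x => -x)

theorem mem_ng {A : Finset ℤ} {x : ℤ} : x ∈ ng A ↔ -x ∈ A := by
  unfold ng
  simp only [Finset.mem_image]
  constructor
  · rintro ⟨a, ha, rfl⟩
    simpa using ha
  · intro h
    exact ⟨-x, h, by simp⟩

theorem card_ng (A : Finset ℤ) : (ng A).card = A.card :=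
  Finset.card_image_of_injective _ neg_injective

theorem rs_ng (A B : Finset ℤ) : restrictedSumset (ng A) (ng B) = ng (restrictedSumset A B) := by
  ext s
  simp only [mem_rs, mem_ng]
  constructor
  · rintro ⟨a, ha, b, hb, h, e⟩
    exact ⟨-a, ha, -b, hb, by omega, by omega⟩
  · rintro ⟨a, ha, b, hb, h, e⟩
    exact ⟨-a, by simpa using ha, -b, by simpa using hb, by omega, by omega⟩

def tr (c : ℤ) (A : Finset ℤ) : Finset ℤ := A.image (fun x => c + x)

theorem mem_tr {A : Finset ℤ} {c x : ℤ} : x ∈ tr c A ↔ ∃ a ∈ A, c + a = x := by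
  unfold tr
  simp only [Finset.mem_image]

theorem card_tr (c : ℤ) (A : Finset ℤ) : (tr c A).card = A.card :=
  Finset.card_image_of_injective _ (add_right_injective c)

theorem low (A B : Finset ℤ) (p : ℤ) (hp : p ∈ A) (hA : ∀ x ∈ A, p ≤ x)
    (hB : ∀ y ∈ B, p < y) (hne : B.Nonempty) :
    A.card + B.card - 2 ≤ (restrictedSumset A B).card := by
  obtain ⟨q, hq, hqm⟩ : ∃ q ∈ B, ∀ y ∈ B, y ≤ q :=
    ⟨B.max' hne, B.max'_mem hne, fun y hy => B.le_max' y hy⟩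
  have hsub : tr p B ∪ tr q ((A.erase p).erase q) ⊆ restrictedSumset A B := by
    intro s hs
    simp only [Finset.mem_union, mem_tr, Finset.mem_erase] at hs
    rw [mem_rs]
    rcases hs with ⟨b, hb, e⟩ | ⟨a, ⟨h1, h2, h3⟩, e⟩
    · exact ⟨p, hp, b, hb, (hB b hb).ne, e⟩
    · exact ⟨a, h3, q, hq, h1, by omega⟩
  have hd : Disjoint (tr p B) (tr q ((A.erase p).erase q)) := by
    rw [Finset.disjoint_left]
    intro s h1 h2
    simp only [mem_tr, Finset.mem_erase] at h1 h2
    obtain ⟨b, hb, e⟩ := h1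
    obtain ⟨a, ⟨h1, h2, h3⟩, e'⟩ := h2
    have := hA a h3
    have := hqm b hb
    omega
  have h := Finset.card_le_card hsub
  rw [Finset.card_union_of_disjoint hd, card_tr, card_tr] at h
  have := Finset.card_erase_of_mem hp
  have := Finset.pred_card_le_card_erase (s := A.erase p) (a := q)
  omega

theorem eqmin (A B : Finset ℤ) (hA : 3 ≤ A.card) (hB : 2 ≤ B.card)
    (h : (restrictedSumset A B).card = A.card + B.card - 3) :
    ∃ p ∈ A, p ∈ B ∧ (∀ x ∈ A, p ≤ x) ∧ ∀ x ∈ B, p ≤ x := by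
  have nA : A.Nonempty := Finset.card_pos.1 (by omega)
  have nB : B.Nonempty := Finset.card_pos.1 (by omega)
  have e : A.min' nA = B.min' nB := by
    rcases lt_trichotomy (A.min' nA) (B.min' nB) with hl | hl | hl
    · have := low A B _ (A.min'_mem nA) (fun x hx => A.min'_le x hx)
        (fun y hy => hl.trans_le (B.min'_le y hy)) nB
      omega
    · exact hl
    · have := low B A _ (B.min'_mem nB) (fun x hx => B.min'_le x hx)
        (fun y hy => hl.trans_le (A.min'_le y hy)) nA
      rw [rs_comm] at this
      omega
  exact ⟨A.min' nA, A.min'_mem nA, e ▸ B.min'_mem nB, fun x hx => A.min'_le x hx,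
    fun x hx => e ▸ B.min'_le x hx⟩

theorem half (A B : Finset ℤ) (p q : ℤ) (hpA : p ∈ A) (hpB : p ∈ B) (hqA : q ∈ A) (hqB : q ∈ B)
    (hpq : p < q)
    (mA : ∀ x ∈ A, p ≤ x ∧ x ≤ q) (mB : ∀ x ∈ B, p ≤ x ∧ x ≤ q)
    (h : (restrictedSumset A B).card = A.card + B.card - 3) : A ⊆ B := by
  have hsub : tr p (B.erase p) ∪ tr q ((A.erase p).erase q) ⊆ restrictedSumset A B := by
    intro s hs
    simp only [Finset.mem_union, mem_tr, Finset.mem_erase] at hs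
    rw [mem_rs]
    rcases hs with ⟨b, ⟨h1, hb⟩, e⟩ | ⟨a, ⟨h1, h2, h3⟩, e⟩
    · exact ⟨p, hpA, b, hb, h1.symm, e⟩
    · exact ⟨a, h3, q, hqB, h1, by omega⟩
  have hd : Disjoint (tr p (B.erase p)) (tr q ((A.erase p).erase q)) := by
    rw [Finset.disjoint_left]
    intro s h1 h2
    simp only [mem_tr, Finset.mem_erase] at h1 h2
    obtain ⟨b, ⟨h0, hb⟩, e⟩ := h1
    obtain ⟨a, ⟨h1, h2, h3⟩, e'⟩ := h2
    have := mA a h3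
    have := mB b hb
    omega
  have e1 := Finset.card_erase_of_mem hpA
  have e2 := Finset.card_erase_of_mem (s := A.erase p) (a := q)
    (Finset.mem_erase.2 ⟨hpq.ne', hqA⟩)
  have e3 := Finset.card_erase_of_mem hpB
  have e4 : 0 < (A.erase p).card := Finset.card_pos.2 ⟨q, Finset.mem_erase.2 ⟨hpq.ne', hqA⟩⟩
  have e5 : 0 < B.card := Finset.card_pos.2 ⟨q, hqB⟩
  have heq := Finset.eq_of_subset_of_card_le hsub (by
    rw [Finset.card_union_of_disjoint hd, card_tr, card_tr]
    omega)
  intro x hx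
  by_cases hxp : x = p
  · rw [hxp]; exact hpB
  have : x + p ∈ restrictedSumset A B := mem_rs.2 ⟨x, hx, p, hpB, hxp, rfl⟩
  rw [← heq] at this
  simp only [Finset.mem_union, mem_tr, Finset.mem_erase] at this
  rcases this with ⟨b, ⟨h1, hb⟩, e⟩ | ⟨a, ⟨h1, h2, h3⟩, e⟩
  · have : x = b := by omega
    rw [this]; exact hb
  · have := mA a h3
    have := mA x hx
    omega

theorem step (A : Finset ℤ) (p r t q : ℤ) (hp : p ∈ A) (hr : r ∈ A) (ht : t ∈ A) (hq : q ∈ A)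
    (hpr : p < r) (hrt : r < t) (htq : t < q)
    (m1 : ∀ x ∈ A, x = p ∨ x = r ∨ t ≤ x) (m2 : ∀ x ∈ A, x ≤ q)
    (h : (restrictedSumset A A).card = A.card + A.card - 3) :
    ∀ y ∈ A, t < y → y - (r - p) ∈ A ∧ t ≤ y - (r - p) := by
  have hsub : tr p {r, t} ∪ tr r ((A.erase p).erase r) ∪ tr q (((A.erase p).erase r).erase q)
      ⊆ restrictedSumset A A := by
    intro s hs
    simp only [Finset.mem_union, mem_tr, Finset.mem_erase, Finset.mem_insert,
      Finset.mem_singleton] at hs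
    rw [mem_rs]
    rcases hs with (⟨b, (rfl | rfl), e⟩ | ⟨a, ⟨h1, h2, h3⟩, e⟩) | ⟨a, ⟨h0, h1, h2, h3⟩, e⟩
    · exact ⟨p, hp, b, hr, by omega, e⟩
    · exact ⟨p, hp, b, ht, by omega, e⟩
    · exact ⟨r, hr, a, h3, h1.symm, e⟩
    · exact ⟨q, hq, a, h3, h0.symm, e⟩
  have hd1 : Disjoint (tr p {r, t}) (tr r ((A.erase p).erase r)) := by
    rw [Finset.disjoint_left]
    intro s h1 h2
    simp only [mem_tr, Finset.mem_erase, Finset.mem_insert, Finset.mem_singleton] at h1 h2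
    obtain ⟨b, hb, e⟩ := h1
    obtain ⟨a, ⟨h1, h2, h3⟩, e'⟩ := h2
    have := m1 a h3
    omega
  have hd2 : Disjoint (tr p {r, t} ∪ tr r ((A.erase p).erase r))
      (tr q (((A.erase p).erase r).erase q)) := by
    rw [Finset.disjoint_left]
    intro s h1 h2
    simp only [Finset.mem_union, mem_tr, Finset.mem_erase, Finset.mem_insert,
      Finset.mem_singleton] at h1 h2
    obtain ⟨a, ⟨h4, h5, h6, h3⟩, e'⟩ := h2
    have := m1 a h3
    rcases h1 with ⟨b, hb, e⟩ | ⟨b, ⟨h1, h2, h3⟩, e⟩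
    · omega
    · have := m2 b h3
      omega
  have k1 : r ∈ A.erase p := Finset.mem_erase.2 ⟨by omega, hr⟩
  have k2 : q ∈ (A.erase p).erase r :=
    Finset.mem_erase.2 ⟨by omega, Finset.mem_erase.2 ⟨by omega, hq⟩⟩
  have e1 := Finset.card_erase_add_one hp
  have e2 := Finset.card_erase_add_one k1
  have e3 := Finset.card_erase_add_one k2
  have e4 : ({r, t} : Finset ℤ).card = 2 := Finset.card_pair hrt.ne
  have heq := Finset.eq_of_subset_of_card_le hsub (by
    rw [Finset.card_union_of_disjoint hd2, Finset.card_union_of_disjoint hd1,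
      card_tr, card_tr, card_tr]
    omega)
  intro y hy hty
  have : p + y ∈ restrictedSumset A A := mem_rs.2 ⟨p, hp, y, hy, by omega, rfl⟩
  rw [← heq] at this
  simp only [Finset.mem_union, mem_tr, Finset.mem_erase, Finset.mem_insert,
    Finset.mem_singleton] at this
  have hyq := m2 y hy
  rcases this with (⟨b, hb, e⟩ | ⟨a, ⟨h1, h2, h3⟩, e⟩) | ⟨a, ⟨h0, h1, h2, h3⟩, e⟩
  · omega
  · have := m1 a h3
    have e : y - (r - p) = a := by omega
    rw [e]
    exact ⟨h3, by omega⟩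
  · have := m1 a h3
    omega

theorem three (A : Finset ℤ) (hA : 5 ≤ A.card) : ∃ p ∈ A, ∃ r ∈ A, ∃ t ∈ A, p < r ∧ r < t ∧
    ∀ x ∈ A, x = p ∨ x = r ∨ t ≤ x := by
  have key : ∀ C : Finset ℤ, 0 < C.card → ∃ p ∈ C, ∀ x ∈ C, p ≤ x := fun C hC =>
    ⟨C.min' (Finset.card_pos.1 hC), C.min'_mem _, fun x hx => C.min'_le x hx⟩
  obtain ⟨p, hp, mp⟩ := key A (by omega)
  have e1 := Finset.card_erase_add_one hp
  obtain ⟨r, hr, mr⟩ := key (A.erase p) (by omega)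
  have e2 := Finset.card_erase_add_one hr
  obtain ⟨t, ht, mt⟩ := key ((A.erase p).erase r) (by omega)
  simp only [Finset.mem_erase] at hr ht mr mt
  refine ⟨p, hp, r, hr.2, t, ht.2.2, ?_, ?_, ?_⟩
  · have := mp r hr.2
    omega
  · have := mr t ht.2
    omega
  · intro x hx
    by_contra hc
    have := mt x ⟨by omega, by omega, hx⟩
    omega

theorem ap_of (A : Finset ℤ) (p q d : ℤ) (hp : p ∈ A) (hq : q ∈ A) (hd : 0 < d)
    (m : ∀ x ∈ A, p ≤ x ∧ x ≤ q) (h : ∀ y ∈ A, y ≠ p → y - d ∈ A) :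
    A = (Finset.range A.card).image fun i : ℕ => p + (i : ℤ) * d := by
  have f : ∀ n : ℕ, ∀ y ∈ A, y - p ≤ n → ∃ i : ℕ, y = p + i * d := by
    intro n
    induction n with
    | zero =>
      intro y hy hn
      have := m y hy
      exact ⟨0, by push_cast at *; omega⟩
    | succ n ih =>
      intro y hy hn
      by_cases hyp : y = p
      · exact ⟨0, by simp [hyp]⟩
      obtain ⟨i, hi⟩ := ih (y - d) (h y hy hyp) (by push_cast at hn; omega)
      exact ⟨i + 1, by push_cast; linarith⟩
  have f' : ∀ y ∈ A, ∃ i : ℕ, y = p + i * d := fun y hy =>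
    f (y - p).toNat y hy (Int.self_le_toNat _)
  obtain ⟨N, hN⟩ := f' q hq
  have g : ∀ k i : ℕ, i + k = N → p + i * d ∈ A := by
    intro k
    induction k with
    | zero => intro i hi; simp at hi; rw [hi, ← hN]; exact hq
    | succ k ih =>
      intro i hi
      have h1 := ih (i + 1) (by omega)
      have h2 := h _ h1 (by push_cast; nlinarith [Int.natCast_nonneg i])
      push_cast at h2
      have e : p + ((i : ℤ) + 1) * d - d = p + i * d := by ring
      rwa [e] at h2
  have e : A = (Finset.range (N + 1)).image fun i : ℕ => p + (i : ℤ) * d := by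
    ext y
    simp only [Finset.mem_image, Finset.mem_range]
    constructor
    · intro hy
      obtain ⟨i, hi⟩ := f' y hy
      refine ⟨i, ?_, hi.symm⟩
      have := (m y hy).2
      rw [hi, hN] at this
      have : (i : ℤ) ≤ N := by
        have h3 : (i : ℤ) * d ≤ N * d := by linarith
        exact le_of_mul_le_mul_right h3 hd
      omega
    · rintro ⟨i, hi, rfl⟩
      exact g (N - i) i (by omega)
  have c : A.card = N + 1 := by
    rw [e, Finset.card_image_of_injective, Finset.card_range]
    intro i j hij
    simp only at hij
    have : (i : ℤ) * d = j * d := by linarith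
    exact_mod_cast mul_right_cancel₀ hd.ne' this
  rw [c]
  exact e

theorem fwd (A : Finset ℤ) (hA : 5 ≤ A.card)
    (h : (restrictedSumset A A).card = A.card + A.card - 3) :
    ∃ τ d : ℤ, d ≠ 0 ∧
        A = (Finset.range A.card).image fun i : ℕ => τ + (i : ℤ) * d := by
  obtain ⟨p, hp, r, hr, t, ht, hpr, hrt, m1⟩ := three A hA
  obtain ⟨q', hq', u', hu', v', hv', hqu, huv, m2⟩ := three (ng A) (by rw [card_ng]; exact hA)
  have hn : (restrictedSumset (ng A) (ng A)).card = (ng A).card + (ng A).card - 3 := by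
    rw [rs_ng, card_ng, card_ng, h]
  have c3 : ∀ a b c : ℤ, ¬ A ⊆ {a, b, c} := fun a b c hc => by
    have := Finset.card_le_card hc
    have := Finset.card_le_three (a := a) (b := b) (c := c)
    omega
  have c4 : ∀ a b c d : ℤ, ¬ A ⊆ {a, b, c, d} := fun a b c d hc => by
    have := Finset.card_le_card hc
    have := Finset.card_le_four (a := a) (b := b) (c := c) (d := d)
    omega
  have m2' : ∀ x ∈ A, x = -q' ∨ x = -u' ∨ x ≤ -v' := by
    intro x hx
    have := m2 (-x) (mem_ng.2 (by simpa using hx))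
    omega
  have hrv : r < -v' := by
    by_contra hc
    apply c4 p r (-q') (-u')
    intro x hx
    have h1 := m1 x hx
    have h2 := m2' x hx
    simp only [Finset.mem_insert, Finset.mem_singleton]
    omega
  have htq : t < -q' := by
    by_contra hc
    apply c3 p r t
    intro x hx
    have h1 := m1 x hx
    have h2 := m2' x hx
    simp only [Finset.mem_insert, Finset.mem_singleton]
    omega
  have s1 := step A p r t (-q') hp hr ht (mem_ng.1 hq') hpr hrt htq m1
    (fun x hx => by have := m2' x hx; omega) h
  have s2' := step (ng A) q' u' v' (-p) hq' hu' hv' (mem_ng.2 (by simpa using hp)) hqu huv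
    (by omega) m2 (fun x hx => by have := m1 _ (mem_ng.1 hx); omega) hn
  have s2 : ∀ y ∈ A, y < -v' → y + (u' - q') ∈ A := by
    intro y hy hlt
    have := mem_ng.1 (s2' (-y) (mem_ng.2 (by simpa using hy)) (by omega)).1
    have e : -(-y - (u' - q')) = y + (u' - q') := by ring
    rwa [e] at this
  have d1 := (s1 _ (mem_ng.1 hq') htq).1
  have d1 := m2' _ d1
  have d2 := m1 _ (s2 p hp (by omega))
  have hde : u' - q' = r - p := by omega
  rw [hde] at s2
  have d3 := s2 r hr hrv
  have d4 := m1 _ d3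
  have d5 : t = r + (r - p) := by
    by_contra hc
    have := (s1 _ d3 (by omega)).2
    omega
  refine ⟨p, r - p, by omega, ap_of A p (-q') (r - p) hp (mem_ng.1 hq') (by omega) ?_ ?_⟩
  · intro x hx
    have h1 := m1 x hx
    have h2 := m2' x hx
    omega
  · intro y hy hyp
    rcases m1 y hy with h1 | h1 | h1
    · exact absurd h1 hyp
    · have e : y - (r - p) = p := by omega
      rw [e]; exact hp
    · rcases h1.eq_or_lt with h1 | h1
      · have e : y - (r - p) = r := by omega
        rw [e]; exact hr
      · exact (s1 y hy h1).1

theorem bwd (A : Finset ℤ) (m : ℕ) (hm : 5 ≤ m) (τ d : ℤ) (hd : d ≠ 0)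
    (h : A = (Finset.range m).image fun i : ℕ => τ + (i : ℤ) * d) :
    (restrictedSumset A A).card = m + m - 3 := by
  have e : restrictedSumset A A =
      (Finset.Icc 1 (m + m - 3)).image fun i : ℕ => 2 * τ + (i : ℤ) * d := by
    ext s
    rw [mem_rs, h]
    simp only [Finset.mem_image, Finset.mem_range, Finset.mem_Icc]
    constructor
    · rintro ⟨_, ⟨i, hi, rfl⟩, _, ⟨j, hj, rfl⟩, hne, rfl⟩
      have : i ≠ j := fun hc => hne (by rw [hc])
      exact ⟨i + j, by omega, by push_cast; ring⟩
    · rintro ⟨k, hk, rfl⟩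
      have main : ∀ i j : ℕ, i < m → j < m → i ≠ j → i + j = k →
          ∃ a, (∃ i : ℕ, i < m ∧ τ + (i : ℤ) * d = a) ∧ ∃ b, (∃ i : ℕ, i < m ∧ τ + (i : ℤ) * d = b) ∧
          a ≠ b ∧ a + b = 2 * τ + (k : ℤ) * d := by
        intro i j hi hj hij hk
        refine ⟨_, ⟨i, hi, rfl⟩, _, ⟨j, hj, rfl⟩, ?_, ?_⟩
        · intro hc
          have : (i : ℤ) * d = j * d := by linarith
          exact hij (by exact_mod_cast mul_right_cancel₀ hd this)
        · rw [← hk]; push_cast; ring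
      by_cases hkm : k < m
      · exact main 0 k (by omega) hkm (by omega) (by omega)
      · exact main (k - (m - 1)) (m - 1) (by omega) (by omega) (by omega) (by omega)
  rw [e, Finset.card_image_of_injective, Nat.card_Icc]
  · omega
  intro i j hij
  simp only at hij
  have : (i : ℤ) * d = j * d := by linarith
  exact_mod_cast mul_right_cancel₀ hd this

theorem stmt_3 (A B : Finset ℤ) (hA : 5 ≤ A.card) (hB : 2 ≤ B.card) :
    (restrictedSumset A B).card = A.card + B.card - 3 ↔
      A = B ∧ ∃ τ d : ℤ, d ≠ 0 ∧
        A = (Finset.range A.card).image fun i : ℕ => τ + (i : ℤ) * d := by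
  constructor
  · intro h
    obtain ⟨p, hpA, hpB, mA, mB⟩ := eqmin A B (by omega) hB h
    obtain ⟨q, hqA, hqB, nA, nB⟩ := eqmin (ng A) (ng B) (by rw [card_ng]; omega)
      (by rw [card_ng]; omega) (by rw [rs_ng, card_ng, card_ng, card_ng, h])
    rw [mem_ng] at hqA hqB
    have nA' : ∀ x ∈ A, x ≤ -q := fun x hx => by
      have := nA (-x) (mem_ng.2 (by simpa using hx))
      omega
    have nB' : ∀ x ∈ B, x ≤ -q := fun x hx => by
      have := nB (-x) (mem_ng.2 (by simpa using hx))
      omega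
    have hpq : p < -q := by
      by_contra hc
      have : A ⊆ {p} := fun x hx => by
        have := nA' x hx
        have := mA x hx
        simp only [Finset.mem_singleton]
        omega
      have := Finset.card_le_card this
      rw [Finset.card_singleton] at this
      omega
    have hAB : A = B := by
      apply Finset.Subset.antisymm
      · exact half A B p (-q) hpA hpB hqA hqB hpq (fun x hx => ⟨mA x hx, nA' x hx⟩)
          (fun x hx => ⟨mB x hx, nB' x hx⟩) h
      · exact half B A p (-q) hpB hpA hqB hqA hpq (fun x hx => ⟨mB x hx, nB' x hx⟩)
          (fun x hx => ⟨mA x hx, nA' x hx⟩) (by rw [rs_comm, h]; omega)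
    subst hAB
    exact ⟨rfl, fwd A hA h⟩
  · rintro ⟨rfl, τ, d, hd, h⟩
    exact bwd A A.card hA τ d hd h
end

section
/- Let p be a prime and let A, B be nonempty subsets of ℤ/pℤ with |A| ≥ 2, |B| ≥ 2, p ≥ |A| + |B| - 2, and such that for all a ∈ A and b ∈ B the sum of the canonical representatives in {0, 1, ..., p-1} of a and b is less than p (equivalently, max A + max B < p in terms of representatives). Then |A +̂ B| = |A| + |B| - 3 if and only if A = B and one of the following holds: (1) |A| = 2 or |A| = 3; (2) |A| = 4 and there exist a, c, d ∈ ℤ/pℤ with A = {a, a + d, c, c + d}; (3) |A| ≥ 5 and A is an arithmetic progression, i.e., there exist τ, d ∈ ℤ/pℤ with d ≠ 0 and A = {τ + i·d : i = 0, 1, ..., |A| - 1}. -/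
/-- The restricted sumset of two finite subsets of `ZMod p`:
`A +̂ B = {a + b : a ∈ A, b ∈ B, a ≠ b}`. -/
def restrictedSumsetZMod {p : ℕ} (A B : Finset (ZMod p)) : Finset (ZMod p) :=
  ((A ×ˢ B).filter fun q => q.1 ≠ q.2).image fun q => q.1 + q.2

def rsZ (A B : Finset ℤ) : Finset ℤ :=
  ((A ×ˢ B).filter fun q => q.1 ≠ q.2).image fun q => q.1 + q.2

theorem mem_rsZ {A B : Finset ℤ} {s : ℤ} :
    s ∈ rsZ A B ↔ ∃ a ∈ A, ∃ b ∈ B, a ≠ b ∧ a + b = s := by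
  simp only [rsZ, Finset.mem_image, Finset.mem_filter, Finset.mem_product, Prod.exists]
  constructor
  · rintro ⟨a, b, ⟨⟨h1, h2⟩, h3⟩, h4⟩
    exact ⟨a, h1, b, h2, h3, h4⟩
  · rintro ⟨a, h1, b, h2, h3, h4⟩
    exact ⟨a, b, ⟨⟨h1, h2⟩, h3⟩, h4⟩

theorem rsZ_comm (A B : Finset ℤ) : rsZ A B = rsZ B A := by
  ext s
  simp only [mem_rsZ]
  constructor
  · rintro ⟨a, h1, b, h2, h3, h4⟩
    exact ⟨b, h2, a, h1, h3.symm, by omega⟩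
  · rintro ⟨a, h1, b, h2, h3, h4⟩
    exact ⟨b, h2, a, h1, h3.symm, by omega⟩

theorem peelZ (A : Finset ℤ) (h : A.Nonempty) :
    ∃ m C, (∀ c ∈ C, c < m) ∧ A = insert m C ∧ C.card + 1 = A.card := by
  refine ⟨A.max' h, A.erase (A.max' h), ?_, ?_, ?_⟩
  · intro c hc
    have h1 := Finset.mem_erase.1 hc
    exact lt_of_le_of_ne (A.le_max' c h1.2) h1.1
  · exact (Finset.insert_erase (A.max'_mem h)).symm
  · exact Finset.card_erase_add_one (A.max'_mem h)

theorem rsZ_mono {A B C D : Finset ℤ} (h1 : A ⊆ C) (h2 : B ⊆ D) : rsZ A B ⊆ rsZ C D := by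
  intro s
  simp only [mem_rsZ]
  rintro ⟨a, ha, b, hb, h⟩
  exact ⟨a, h1 ha, b, h2 hb, h⟩

theorem card_add_one_le {S T : Finset ℤ} {x : ℤ} (h : S ⊆ T) (hx : x ∈ T) (hs : ∀ s ∈ S, s < x) :
    S.card + 1 ≤ T.card := by
  have h1 : x ∉ S := fun h => lt_irrefl _ (hs x h)
  rw [← Finset.card_insert_of_notMem h1]
  exact Finset.card_le_card (Finset.insert_subset hx h)

theorem card_add_two_le {S T : Finset ℤ} {x y : ℤ} (h : S ⊆ T) (hx : x ∈ T) (hy : y ∈ T)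
    (hs : ∀ s ∈ S, s < x) (hxy : x < y) : S.card + 2 ≤ T.card := by
  have h1 : x ∉ S := fun h => lt_irrefl _ (hs x h)
  have h2 := card_add_one_le (S := insert x S) (T := T) (x := y) (Finset.insert_subset hx h) hy
    (by
      intro s h
      rcases Finset.mem_insert.1 h with h | h
      · omega
      · have := hs s h; omega)
  rw [Finset.card_insert_of_notMem h1] at h2
  omega

/-- the common-maximum step -/
theorem step_two {A B : Finset ℤ} {m : ℤ} (hA : A.Nonempty) (hB : B.Nonempty)
    (hAB : ¬ (A = B ∧ A.card = 1)) (hmA : ∀ a ∈ A, a < m) (hmB : ∀ b ∈ B, b < m) :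
    (rsZ A B).card + 2 ≤ (rsZ (insert m A) (insert m B)).card := by
  have key : ∀ x y : ℤ, (x ∈ A ∨ x ∈ B) → (y ∈ A ∨ y ∈ B) → x < y →
      (∀ s ∈ rsZ A B, s < m + x) → 
      (rsZ A B).card + 2 ≤ (rsZ (insert m A) (insert m B)).card := by
    have mem : ∀ x, (x ∈ A ∨ x ∈ B) → m + x ∈ rsZ (insert m A) (insert m B) := by
      intro x hx
      rw [mem_rsZ]
      rcases hx with hx | hx
      · exact ⟨x, by simp [hx], m, by simp, (hmA x hx).ne, by omega⟩
      · exact ⟨m, by simp, x, by simp [hx], (hmB x hx).ne', by omega⟩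
    intro x y hx hy hxy hs
    exact card_add_two_le (rsZ_mono (Finset.subset_insert _ _) (Finset.subset_insert _ _))
      (mem x hx) (mem y hy) hs (by omega)
  have hU : (A ∪ B).Nonempty := hA.mono Finset.subset_union_left
  obtain ⟨y, C, hC, hUC, -⟩ := peelZ _ hU
  have hCne : C.Nonempty := by
    by_contra hne
    rw [Finset.not_nonempty_iff_eq_empty] at hne
    subst hne
    have e1 : A = {y} := (Finset.Nonempty.subset_singleton_iff hA).1
      (Finset.subset_union_left.trans hUC.le)
    have e2 : B = {y} := (Finset.Nonempty.subset_singleton_iff hB).1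
      (Finset.subset_union_right.trans hUC.le)
    exact hAB ⟨e1.trans e2.symm, by simp [e1]⟩
  obtain ⟨x, D, hD, hCD, -⟩ := peelZ _ hCne
  have hmem : ∀ z, (z ∈ A ∨ z ∈ B) ↔ z = y ∨ z = x ∨ z ∈ D := by
    intro z
    rw [← Finset.mem_union, hUC, hCD]; simp
  have hxy : x < y := hC x (by simp [hCD])
  refine key x y ((hmem x).2 (by simp)) ((hmem y).2 (by simp)) hxy ?_
  intro s hs
  obtain ⟨a, ha, b, hb, hab, rfl⟩ := mem_rsZ.1 hs
  have a1 := hmA a ha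
  have b1 := hmB b hb
  have a2 := (hmem a).1 (Or.inl ha)
  have b2 := (hmem b).1 (Or.inr hb)
  rcases a2 with a2 | a2 | a2 <;> rcases b2 with b2 | b2 | b2 <;>
    (try have a3 := hD _ a2) <;> (try have b3 := hD _ b2) <;> omega

theorem lower_ne : ∀ (n : ℕ) (A B : Finset ℤ), A.card + B.card = n → A.Nonempty → B.Nonempty →
    A ≠ B → A.card + B.card ≤ (rsZ A B).card + 2 := by
  intro n
  induction n using Nat.strong_induction_on with
  | _ n ih =>
  -- the unequal maxima case
  have hlt : ∀ (A C : Finset ℤ) (a b : ℤ) , (∀ x ∈ A, x ≤ a) → a ∈ A → (∀ x ∈ C, x < b) →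
      a < b → A.card + (C.card + 1) = n → A.card + (C.card + 1) ≤ (rsZ A (insert b C)).card + 2 := by
    intro A C a b hAa ha hC hab hn
    have hA : A.Nonempty := ⟨a, ha⟩
    have hmem : a + b ∈ rsZ A (insert b C) := mem_rsZ.2 ⟨a, ha, b, by simp, hab.ne, rfl⟩
    rcases C.eq_empty_or_nonempty with rfl | hCne
    · have : A.card ≤ (rsZ A (insert b ∅)).card := by
        apply Finset.card_le_card_of_injOn (fun x => x + b)
        · intro x hx
          exact mem_rsZ.2 ⟨x, hx, b, by simp, by have := hAa x hx; omega, rfl⟩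
        · intro x _ y _ h
          simpa using h
      simp at this ⊢
      omega
    by_cases hAC : A = C
    · subst hAC
      obtain ⟨m, D, hD, hAD, hcard⟩ := peelZ A hA
      rcases D.eq_empty_or_nonempty with rfl | hDne
      · have := Finset.card_pos.2 ⟨_, hmem⟩
        simp at hcard
        omega
      have h1 := ih (D.card + A.card) (by omega) D A rfl hDne hA (by
        intro h; rw [h] at hcard; omega)
      have h2 := rsZ_mono (B := A) (D := A) (A := D) (C := A) (by rw [hAD]; simp) (le_refl _)
      have h3 := Finset.card_le_card h2
      obtain ⟨x, E, hE, hDE, -⟩ := peelZ D hDne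
      have hxA : x ∈ A := by rw [hAD, hDE]; simp
      have hmA : m ∈ A := by rw [hAD]; simp
      have hxm : x < m := hD x (by rw [hDE]; simp)
      have h4 : (rsZ A A).card + 2 ≤ (rsZ A (insert b A)).card := by
        apply card_add_two_le (x := x + b) (y := m + b)
          (rsZ_mono (le_refl _) (Finset.subset_insert _ _))
        · exact mem_rsZ.2 ⟨x, hxA, b, by simp, (hC x hxA).ne, rfl⟩
        · exact mem_rsZ.2 ⟨m, hmA, b, by simp, (hC m hmA).ne, rfl⟩
        · intro s hs
          obtain ⟨u, hu, v, hv, huv, rfl⟩ := mem_rsZ.1 hs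
          have u1 := hC u hu
          have v1 := hC v hv
          rw [hAD, hDE] at hu hv
          simp only [Finset.mem_insert] at hu hv
          rcases hu with a2 | a2 | a2 <;> rcases hv with b2 | b2 | b2 <;>
            (try have a3 := hE _ a2) <;> (try have b3 := hE _ b2) <;> omega
        · omega
      omega
    · have h1 := ih (A.card + C.card) (by omega) A C rfl hA hCne hAC
      have h2 := card_add_one_le (rsZ_mono (le_refl A) (Finset.subset_insert b C)) hmem (by
        intro s hs
        obtain ⟨u, hu, v, hv, huv, rfl⟩ := mem_rsZ.1 hs
        have := hAa u hu
        have := hC v hv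
        omega)
      omega
  intro A B hn hA hB hne
  obtain ⟨a, A', hA', hAA, hcA⟩ := peelZ A hA
  obtain ⟨b, B', hB', hBB, hcB⟩ := peelZ B hB
  have hle : ∀ x ∈ A, x ≤ a := by
    intro x hx
    rw [hAA] at hx
    rcases Finset.mem_insert.1 hx with h | h
    · exact h.le
    · exact (hA' x h).le
  have hle' : ∀ x ∈ B, x ≤ b := by
    intro x hx
    rw [hBB] at hx
    rcases Finset.mem_insert.1 hx with h | h
    · exact h.le
    · exact (hB' x h).le
  rcases lt_trichotomy a b with hab | hab | hab
  · have := hlt A B' a b hle (by rw [hAA]; simp) hB' hab (by omega)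
    rw [hcB, ← hBB] at this
    exact this
  · subst hab
    have hne' : A' ≠ B' := by
      rintro rfl
      exact hne (hAA.trans hBB.symm)
    have single : ∀ (X Y : Finset ℤ), (∀ y ∈ Y, y < a) → a ∈ X → Y.card ≤ (rsZ X (insert a Y)).card := by
      intro X Y hY haX
      apply Finset.card_le_card_of_injOn (fun x => a + x)
      · intro x hx
        exact mem_rsZ.2 ⟨a, haX, x, by simp [Finset.mem_coe.1 hx], (hY x hx).ne', rfl⟩
      · intro x _ y _ h
        simpa using h
    rcases A'.eq_empty_or_nonempty with h0 | hA'ne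
    · have := single A B' hB' (by rw [hAA]; simp)
      rw [← hBB] at this
      rw [h0] at hcA
      simp at hcA
      omega
    rcases B'.eq_empty_or_nonempty with h0 | hB'ne
    · have := single B A' hA' (by rw [hBB]; simp)
      rw [← hAA, rsZ_comm] at this
      rw [h0] at hcB
      simp at hcB
      omega
    have h1 := ih (A'.card + B'.card) (by omega) A' B' rfl hA'ne hB'ne hne'
    have h2 := step_two hA'ne hB'ne (fun h => hne' h.1) hA' hB'
    rw [← hAA, ← hBB] at h2
    omega
  · have := hlt B A' b a hle' (by rw [hBB]; simp) hA' hab (by omega)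
    rw [hcA, ← hAA, rsZ_comm] at this
    omega

theorem lower_eq (A : Finset ℤ) (h : 2 ≤ A.card) : 2 * A.card ≤ (rsZ A A).card + 3 := by
  obtain ⟨m, D, hD, hAD, hcard⟩ := peelZ A (Finset.card_pos.1 (by omega))
  have h1 := lower_ne _ D A rfl (Finset.card_pos.1 (by omega)) (Finset.card_pos.1 (by omega)) (by
    intro h; rw [h] at hcard; omega)
  have h2 := rsZ_mono (B := A) (D := A) (A := D) (C := A) (by rw [hAD]; simp) (le_refl _)
  have h3 := Finset.card_le_card h2
  omega

/-- structure of a tight set: top four elements -/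
theorem tight_key (A : Finset ℤ) (h : 4 ≤ A.card) (ht : (rsZ A A).card + 3 = 2 * A.card) :
    ∃ m A' a b c D, A = insert m A' ∧ A' = insert a (insert b (insert c D)) ∧
      (∀ x ∈ D, x < c) ∧ c < b ∧ b < a ∧ a < m ∧ m + c = a + b ∧
      D.card + 4 = A.card ∧ A'.card + 1 = A.card ∧ (rsZ A' A').card + 3 = 2 * A'.card ∧
      (∀ x ∈ A', x < m) := by
  obtain ⟨m, A', hm, hA, h1⟩ := peelZ A (Finset.card_pos.1 (by omega))
  obtain ⟨a, A2, ha, hA2, h2⟩ := peelZ A' (Finset.card_pos.1 (by omega))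
  obtain ⟨b, A3, hb, hA3, h3⟩ := peelZ A2 (Finset.card_pos.1 (by omega))
  obtain ⟨c, D, hc, hA4, h4⟩ := peelZ A3 (Finset.card_pos.1 (by omega))
  have hcb : c < b := hb c (by rw [hA4]; simp)
  have hba : b < a := ha b (by rw [hA3]; simp)
  have ham : a < m := hm a (by rw [hA2]; simp)
  have haA : a ∈ A' := by rw [hA2]; simp
  have hbA : b ∈ A' := by rw [hA2, hA3]; simp
  have hcA : c ∈ A' := by rw [hA2, hA3, hA4]; simp
  have hst : A' = insert a (insert b (insert c D)) := by rw [hA2, hA3, hA4]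
  have hmA : m ∈ A := by rw [hA]; simp
  have hsub : A' ⊆ A := by rw [hA]; simp
  have hlow := lower_eq A' (by omega)
  -- bounds on sums in A'
  have hsum : ∀ s ∈ rsZ A' A', s = a + b ∨ s ≤ a + c := by
    intro s hs
    obtain ⟨u, hu, v, hv, huv, rfl⟩ := mem_rsZ.1 hs
    rw [hst] at hu hv
    simp only [Finset.mem_insert] at hu hv
    rcases hu with a2 | a2 | a2 | a2 <;> rcases hv with b2 | b2 | b2 | b2 <;>
      (try have a3 := hc _ a2) <;> (try have b3 := hc _ b2) <;> omega
  have n1 : m + b ∉ rsZ A' A' := by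
    intro hh; have := hsum _ hh; omega
  have n2 : m + a ∉ insert (m + b) (rsZ A' A') := by
    intro hh
    rcases Finset.mem_insert.1 hh with hh | hh
    · omega
    · have := hsum _ hh; omega
  have hS : insert (m + a) (insert (m + b) (rsZ A' A')) ⊆ rsZ A A := by
    apply Finset.insert_subset
    · exact mem_rsZ.2 ⟨m, hmA, a, hsub haA, by omega, rfl⟩
    apply Finset.insert_subset
    · exact mem_rsZ.2 ⟨m, hmA, b, hsub hbA, by omega, rfl⟩
    exact rsZ_mono hsub hsub
  have hcS : (insert (m + a) (insert (m + b) (rsZ A' A'))).card = (rsZ A' A').card + 2 := by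
    rw [Finset.card_insert_of_notMem n2, Finset.card_insert_of_notMem n1]
  have hle := Finset.card_le_card hS
  have heq := Finset.eq_of_subset_of_card_le hS (by omega)
  have hmc : m + c ∈ rsZ A A := mem_rsZ.2 ⟨m, hmA, c, hsub hcA, by omega, rfl⟩
  have hfin : m + c = a + b := by
    rw [← heq] at hmc
    simp only [Finset.mem_insert] at hmc
    rcases hmc with hh | hh | hh
    · omega
    · omega
    · have := hsum _ hh; omega
  exact ⟨m, A', a, b, c, D, hA, hst, hc, hcb, hba, ham, hfin, by omega, h1, by omega, hm⟩

theorem tight_AP : ∀ n : ℕ, 5 ≤ n → ∀ A : Finset ℤ, A.card = n →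
    (rsZ A A).card + 3 = 2 * A.card →
    ∃ t d : ℤ, 0 < d ∧ A = (Finset.range n).image fun i : ℕ => t + (i : ℤ) * d := by
  intro n hn
  induction n, hn using Nat.le_induction with
  | base =>
    intro A hA ht
    obtain ⟨m, A', a, b, c, D, e1, e2, hD, hcb, hba, ham, hs, k1, k2, ht', hm⟩ :=
      tight_key A (by omega) ht
    obtain ⟨m', A'', a', b', c', D', f1, f2, hD', hcb', hba', ham', hs', l1, l2, -, hm'⟩ :=
      tight_key A' (by omega) ht'
    obtain ⟨x, hx⟩ := Finset.card_eq_one.1 (show D.card = 1 by omega)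
    have hD'0 := Finset.card_eq_zero.1 (show D'.card = 0 by omega)
    subst hD'0 hx
    have hxc := hD x (by simp)
    have E : ∀ z, (z = a ∨ z = b ∨ z = c ∨ z = x) ↔ (z = m' ∨ z = a' ∨ z = b' ∨ z = c') := by
      intro z
      have : z ∈ A' ↔ z ∈ insert m' A'' := by rw [f1]
      rw [f2] at this
      rw [e2] at this
      simpa using this
    have E1 : a + x = b + c := by
      have q1 := (E a).1 (by simp)
      have q2 := (E b).1 (by simp)
      have q3 := (E c).1 (by simp)
      have q4 := (E x).1 (by simp)
      omega
    have hAeq : A = {m, a, b, c, x} := by rw [e1, e2]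
    by_cases hd : a - b = b - c
    · refine ⟨x, a - b, by omega, ?_⟩
      rw [hAeq]
      ext z
      simp [Finset.range_add_one]
      constructor
      · intro h; omega
      · intro h; omega
    · exfalso
      have hmem : ∀ u v, u ∈ A → v ∈ A → u ≠ v → u + v ∈ rsZ A A := fun u v hu hv huv =>
        mem_rsZ.2 ⟨u, hu, v, hv, huv, rfl⟩
      have hsub : ({m + a, m + b, m + c, m + x, a + c, a + x, b + x, c + x} : Finset ℤ)
          ⊆ rsZ A A := by
        have i1 : m ∈ A := by simp [hAeq]
        have i2 : a ∈ A := by simp [hAeq]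
        have i3 : b ∈ A := by simp [hAeq]
        have i4 : c ∈ A := by simp [hAeq]
        have i5 : x ∈ A := by simp [hAeq]
        intro z hz
        simp only [Finset.mem_insert, Finset.mem_singleton] at hz
        rcases hz with rfl | rfl | rfl | rfl | rfl | rfl | rfl | rfl <;> apply hmem <;>
          first | assumption | omega
      have hc := Finset.card_le_card hsub
      have : ({m + a, m + b, m + c, m + x, a + c, a + x, b + x, c + x} : Finset ℤ).card = 8 := by
        repeat rw [Finset.card_insert_of_notMem (by
          simp only [Finset.mem_insert, Finset.mem_singleton]; omega)]
        simp
      omega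
  | succ n hn ih =>
    intro A hA ht
    obtain ⟨m, A', a, b, c, D, e1, e2, hD, hcb, hba, ham, hs, k1, k2, ht', hm⟩ :=
      tight_key A (by omega) ht
    obtain ⟨t, d, hd, hAP⟩ := ih A' (by omega) ht'
    refine ⟨t, d, hd, ?_⟩
    have hform : ∀ z, z ∈ A' ↔ ∃ i : ℕ, i < n ∧ t + (i : ℤ) * d = z := by
      intro z; rw [hAP]; simp
    have hst : ∀ z, z ∈ A' ↔ z = a ∨ z = b ∨ z = c ∨ z ∈ D := by
      intro z; rw [e2]; simp
    have q1 : t + ((n - 1 : ℕ) : ℤ) * d ∈ A' := (hform _).2 ⟨n - 1, by omega, rfl⟩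
    have q2 : t + ((n - 2 : ℕ) : ℤ) * d ∈ A' := (hform _).2 ⟨n - 2, by omega, rfl⟩
    have q3 : t + ((n - 3 : ℕ) : ℤ) * d ∈ A' := (hform _).2 ⟨n - 3, by omega, rfl⟩
    obtain ⟨i, hi, hia⟩ := (hform a).1 ((hst a).2 (by simp))
    obtain ⟨j, hj, hjb⟩ := (hform b).1 ((hst b).2 (by simp))
    obtain ⟨k, hk, hkc⟩ := (hform c).1 ((hst c).2 (by simp))
    have hmono : ∀ u v : ℕ, t + (u : ℤ) * d < t + (v : ℤ) * d ↔ u < v := by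
      intro u v
      constructor
      · intro h
        by_contra hh
        have : (v : ℤ) ≤ u := by exact_mod_cast not_lt.1 hh
        nlinarith
      · intro h
        have : (u : ℤ) < v := by exact_mod_cast h
        nlinarith
    have hinj : ∀ u v : ℕ, t + (u : ℤ) * d = t + (v : ℤ) * d → u = v := by
      intro u v h
      have a1 := hmono u v
      have a2 := hmono v u
      omega
    rw [← hia, ← hjb, hmono] at hba
    rw [← hkc, ← hjb, hmono] at hcb
    have conv : ∀ w : ℕ, t + (w : ℤ) * d ∈ A' → w = i ∨ w = j ∨ w = k ∨ w < k := by
      intro w hw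
      rcases (hst _).1 hw with h | h | h | h
      · left; apply hinj; rw [h, hia]
      · right; left; apply hinj; rw [h, hjb]
      · right; right; left; apply hinj; rw [h, hkc]
      · right; right; right; rw [← hmono, hkc]; exact hD _ h
    have r1 := conv _ q1
    have r2 := conv _ q2
    have r3 := conv _ q3
    have s1 : i = j + 1 := by omega
    have s2 : j = k + 1 := by omega
    have s3 : n = i + 1 := by omega
    have hmn : m = t + (n : ℤ) * d := by
      have : m = a + b - c := by omega
      rw [this, ← hia, ← hjb, ← hkc, s3, s1, s2]
      push_cast
      ring
    rw [Finset.range_add_one, Finset.image_insert, ← hAP, ← hmn, e1]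

def liftZ {p : ℕ} (A : Finset (ZMod p)) : Finset ℤ := A.image fun x => (x.val : ℤ)

theorem mem_liftZ {p : ℕ} {A : Finset (ZMod p)} {z : ℤ} :
    z ∈ liftZ A ↔ ∃ a ∈ A, (a.val : ℤ) = z := by
  simp [liftZ]

theorem liftZ_injF (p : ℕ) [NeZero p] : Function.Injective (fun x : ZMod p => (x.val : ℤ)) := by
  intro x y h
  exact ZMod.val_injective p (Int.natCast_inj.1 h)

theorem card_liftZ {p : ℕ} [NeZero p] (A : Finset (ZMod p)) : (liftZ A).card = A.card :=
  Finset.card_image_of_injective _ (liftZ_injF p)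

theorem liftZ_inj {p : ℕ} [NeZero p] {A B : Finset (ZMod p)} (h : liftZ A = liftZ B) : A = B :=
  Finset.image_injective (liftZ_injF p) h

theorem liftZ_back {p : ℕ} [NeZero p] (A : Finset (ZMod p)) :
    (liftZ A).image (fun z : ℤ => (z : ZMod p)) = A := by
  rw [liftZ, Finset.image_image]
  conv_rhs => rw [← Finset.image_id (s := A)]
  apply Finset.image_congr
  intro x _
  simp

theorem mem_rsM {p : ℕ} {A B : Finset (ZMod p)} {s : ZMod p} :
    s ∈ restrictedSumsetZMod A B ↔ ∃ a ∈ A, ∃ b ∈ B, a ≠ b ∧ a + b = s := by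
  simp only [restrictedSumsetZMod, Finset.mem_image, Finset.mem_filter, Finset.mem_product,
    Prod.exists]
  constructor
  · rintro ⟨a, b, ⟨⟨h1, h2⟩, h3⟩, h4⟩
    exact ⟨a, h1, b, h2, h3, h4⟩
  · rintro ⟨a, h1, b, h2, h3, h4⟩
    exact ⟨a, b, ⟨⟨h1, h2⟩, h3⟩, h4⟩

theorem liftZ_rs {p : ℕ} [NeZero p] (A B : Finset (ZMod p))
    (hval : ∀ a ∈ A, ∀ b ∈ B, (a : ZMod p).val + (b : ZMod p).val < p) :
    liftZ (restrictedSumsetZMod A B) = rsZ (liftZ A) (liftZ B) := by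
  ext z
  rw [mem_liftZ, mem_rsZ]
  constructor
  · rintro ⟨s, hs, rfl⟩
    obtain ⟨a, ha, b, hb, hab, rfl⟩ := mem_rsM.1 hs
    refine ⟨a.val, mem_liftZ.2 ⟨a, ha, rfl⟩, b.val, mem_liftZ.2 ⟨b, hb, rfl⟩,
      fun h => hab (liftZ_injF p h), ?_⟩
    rw [ZMod.val_add_of_lt (hval a ha b hb)]
    push_cast
    rfl
  · rintro ⟨x, hx, y, hy, hxy, rfl⟩
    obtain ⟨a, ha, rfl⟩ := mem_liftZ.1 hx
    obtain ⟨b, hb, rfl⟩ := mem_liftZ.1 hy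
    refine ⟨a + b, mem_rsM.2 ⟨a, ha, b, hb, fun h => hxy (by rw [h]), rfl⟩, ?_⟩
    rw [ZMod.val_add_of_lt (hval a ha b hb)]
    push_cast
    rfl

theorem stmt_11 (p : ℕ) (hp : p.Prime) (A B : Finset (ZMod p))
    (hA : 2 ≤ A.card) (hB : 2 ≤ B.card)
    (hpcard : A.card + B.card - 2 ≤ p)
    (hval : ∀ a ∈ A, ∀ b ∈ B, (a : ZMod p).val + (b : ZMod p).val < p) :
    (restrictedSumsetZMod A B).card = A.card + B.card - 3 ↔
      A = B ∧
        ((A.card = 2 ∨ A.card = 3) ∨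
         (A.card = 4 ∧ ∃ a c d : ZMod p, A = {a, a + d, c, c + d}) ∨
         (5 ≤ A.card ∧ ∃ τ d : ZMod p, d ≠ 0 ∧
            A = (Finset.range A.card).image fun i : ℕ => τ + (i : ZMod p) * d)) := by
  have : NeZero p := ⟨hp.ne_zero⟩
  have hrs := liftZ_rs A B hval
  have hcard : (rsZ (liftZ A) (liftZ B)).card = (restrictedSumsetZMod A B).card := by
    rw [← hrs, card_liftZ]
  have cA := card_liftZ A
  have cB := card_liftZ B
  constructor
  · intro h
    have hAB : A = B := by
      by_contra hne
      have := lower_ne _ (liftZ A) (liftZ B) rfl (Finset.card_pos.1 (by omega))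
        (Finset.card_pos.1 (by omega)) (fun h => hne (liftZ_inj h))
      omega
    refine ⟨hAB, ?_⟩
    subst hAB
    have ht : (rsZ (liftZ A) (liftZ A)).card + 3 = 2 * (liftZ A).card := by omega
    by_cases h4 : A.card = 4
    · right; left
      refine ⟨h4, ?_⟩
      obtain ⟨m, A', a, b, c, D, e1, e2, hD, hcb, hba, ham, hs, k1, k2, ht', hm⟩ :=
        tight_key (liftZ A) (by omega) ht
      have hD0 := Finset.card_eq_zero.1 (show D.card = 0 by omega)
      subst hD0
      refine ⟨(c : ZMod p), (b : ZMod p), (a : ZMod p) - c, ?_⟩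
      rw [← liftZ_back A, e1, e2]
      have hmz : (m : ZMod p) = b + (a - c) := by
        have : m = b + (a - c) := by omega
        rw [this]; push_cast; rfl
      ext z
      simp [hmz]
      tauto
    by_cases h5 : 5 ≤ A.card
    · right; right
      refine ⟨h5, ?_⟩
      obtain ⟨t, d, hd, hAP⟩ := tight_AP A.card h5 (liftZ A) cA ht
      have hform : A = (Finset.range A.card).image
          fun i : ℕ => (t : ZMod p) + (i : ZMod p) * (d : ZMod p) := by
        conv_lhs => rw [← liftZ_back A, hAP, Finset.image_image]
        apply Finset.image_congr
        intro x _
        simp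
      refine ⟨(t : ZMod p), (d : ZMod p), ?_, hform⟩
      intro h0
      rw [h0] at hform
      have hsub : A ⊆ {(t : ZMod p)} := by
        intro z hz
        rw [hform] at hz
        simp at hz
        simp [hz.2]
      have := Finset.card_le_card hsub
      simp at this
      omega
    · left; omega
  · rintro ⟨rfl, hcase⟩
    have hlow := lower_eq (liftZ A) (by omega)
    suffices hup : (restrictedSumsetZMod A A).card ≤ A.card + A.card - 3 by omega
    rcases hcase with (h2 | h3) | ⟨h4, a, c, d, h⟩ | ⟨h5, t, d, hd, h⟩
    · obtain ⟨x, y, hxy, h⟩ := Finset.card_eq_two.1 h2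
      have : restrictedSumsetZMod A A ⊆ {x + y} := by
        intro z hz
        obtain ⟨u, hu, v, hv, huv, rfl⟩ := mem_rsM.1 hz
        rw [h] at hu hv
        simp only [Finset.mem_insert, Finset.mem_singleton] at hu hv ⊢
        grind
      have := (Finset.card_le_card this).trans (Finset.card_singleton _).le
      omega
    · obtain ⟨x, y, w, -, -, -, h⟩ := Finset.card_eq_three.1 h3
      have : restrictedSumsetZMod A A ⊆ {x + y, x + w, y + w} := by
        intro z hz
        obtain ⟨u, hu, v, hv, huv, rfl⟩ := mem_rsM.1 hz
        rw [h] at hu hv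
        simp only [Finset.mem_insert, Finset.mem_singleton] at hu hv ⊢
        grind
      have := (Finset.card_le_card this).trans Finset.card_le_three
      omega
    · have : restrictedSumsetZMod A A ⊆ {a + a + d, a + c, a + c + d, a + c + d + d, c + c + d} := by
        intro z hz
        obtain ⟨u, hu, v, hv, huv, rfl⟩ := mem_rsM.1 hz
        rw [h] at hu hv
        simp only [Finset.mem_insert, Finset.mem_singleton] at hu hv ⊢
        rcases hu with rfl | rfl | rfl | rfl <;> rcases hv with rfl | rfl | rfl | rfl <;>
          first
          | exact absurd rfl huv
          | (left; ring; done)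
          | (right; left; ring; done)
          | (right; right; left; ring; done)
          | (right; right; right; left; ring; done)
          | (right; right; right; right; ring; done)
      have := (Finset.card_le_card this).trans Finset.card_le_five
      omega
    · have : restrictedSumsetZMod A A ⊆
          (Finset.Icc 1 (2 * A.card - 3)).image fun i : ℕ => t + t + (i : ZMod p) * d := by
        intro z hz
        obtain ⟨u, hu, v, hv, huv, rfl⟩ := mem_rsM.1 hz
        rw [h] at hu hv
        obtain ⟨i, hi, rfl⟩ := Finset.mem_image.1 hu
        obtain ⟨j, hj, rfl⟩ := Finset.mem_image.1 hv
        have hij : i ≠ j := by rintro rfl; exact huv rfl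
        rw [Finset.mem_range] at hi hj
        refine Finset.mem_image.2 ⟨i + j, Finset.mem_Icc.2 (by omega), ?_⟩
        push_cast
        ring
      have := (Finset.card_le_card this).trans Finset.card_image_le
      simp at this
      omega
end

section
/- Let p be a prime and let A, B be nonempty subsets of ℤ/pℤ with |B| ≥ 2, |A| ≥ 5, p ≥ |A| + |B|, and |A +̂ B| = |A| + |B| - 3. Let d ∈ ℤ/pℤ with d ≠ 0 (so d generates the additive group ℤ/pℤ), and suppose A = {τ + i·d : i = 0, 1, ..., |A| - 1} for some τ ∈ ℤ/pℤ. Then B has a gap with respect to d of length at least |A|: there exists a natural number m such that for every j with 0 ≤ j ≤ |A| - 1, the element (m + j)·d of ℤ/pℤ does not belong to B. -/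
theorem stmt_12 (p : ℕ) (hp : p.Prime) (A B : Finset (ZMod p))
    (hB : 2 ≤ B.card) (hA : 5 ≤ A.card)
    (hpcard : A.card + B.card ≤ p)
    (hcrit : (restrictedSumsetZMod A B).card = A.card + B.card - 3)
    (d : ZMod p) (hd : d ≠ 0) (τ : ZMod p)
    (hAform : A = (Finset.range A.card).image fun i : ℕ => τ + (i : ZMod p) * d) :
    ∃ m : ℕ, ∀ j : ℕ, j ≤ A.card - 1 → ((m + j : ℕ) : ZMod p) * d ∉ B := by
  haveI : Fact p.Prime := ⟨hp⟩
  by_contra! hno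
  set k := A.card with hk
  have memA : ∀ i : ℕ, i < k → τ + (i : ZMod p) * d ∈ A := by
    intro i hi
    rw [hAform]
    exact Finset.mem_image_of_mem (fun i : ℕ => τ + (i : ZMod p) * d) (Finset.mem_range.2 hi)
  have memS : ∀ a ∈ A, ∀ b ∈ B, a ≠ b → a + b ∈ restrictedSumsetZMod A B := by
    intro a ha b hb hab
    unfold restrictedSumsetZMod
    exact Finset.mem_image.2 ⟨(a, b), Finset.mem_filter.2 ⟨Finset.mem_product.2 ⟨ha, hb⟩, hab⟩, rfl⟩
  have key : ∀ x, x ∉ restrictedSumsetZMod A B → ∃ i : ℕ, i < k ∧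
      τ + (i : ZMod p) * d ∈ B ∧ x = 2 * (τ + (i : ZMod p) * d) := by
    intro x hx
    obtain ⟨j, hj, hb⟩ := hno (((x - τ) / d - ((k - 1 : ℕ) : ZMod p)).val)
    have e : ((((x - τ) / d - ((k - 1 : ℕ) : ZMod p)).val + j : ℕ) : ZMod p) * d
        = x - (τ + ((k - 1 - j : ℕ) : ZMod p) * d) := by
      rw [Nat.cast_add, ZMod.natCast_zmod_val, Nat.cast_sub hj]
      field_simp
      ring
    rw [e] at hb
    have ha := memA (k - 1 - j) (by omega)
    by_cases h : τ + ((k - 1 - j : ℕ) : ZMod p) * d = x - (τ + ((k - 1 - j : ℕ) : ZMod p) * d)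
    · refine ⟨k - 1 - j, by omega, ?_, ?_⟩
      · rw [h]; exact hb
      · linear_combination -h
    · exfalso
      apply hx
      have := memS _ ha _ hb h
      rwa [add_sub_cancel] at this
  have hc : 2 < ((restrictedSumsetZMod A B)ᶜ).card := by
    rw [Finset.card_compl, ZMod.card, hcrit]
    omega
  -- no two lost sums may interact
  have inter : ∀ i j : ℕ, j ≤ 2 * i → 2 * i - j < k → τ + (j : ZMod p) * d ∈ B →
      2 * (τ + (i : ZMod p) * d) ∉ restrictedSumsetZMod A B →
      2 * (τ + (i : ZMod p) * d) = 2 * (τ + (j : ZMod p) * d) := by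
    intro i j h1 h2 hb hx
    have e : (τ + ((2 * i - j : ℕ) : ZMod p) * d) + (τ + (j : ZMod p) * d)
        = 2 * (τ + (i : ZMod p) * d) := by
      rw [Nat.cast_sub h1]; push_cast; ring
    by_contra hne
    apply hx
    rw [← e]
    refine memS _ (memA _ h2) _ hb ?_
    intro h
    apply hne
    rw [← e, h]; ring
  have three : ∀ a b c : ℕ, a < b → b < c → c < k →
      τ + (a : ZMod p) * d ∈ B → τ + (c : ZMod p) * d ∈ B →
      2 * (τ + (b : ZMod p) * d) ∉ restrictedSumsetZMod A B →
      2 * (τ + (a : ZMod p) * d) ≠ 2 * (τ + (b : ZMod p) * d) →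
      2 * (τ + (b : ZMod p) * d) ≠ 2 * (τ + (c : ZMod p) * d) → False := by
    intro a b c hab hbc hck ha hc hb n1 n2
    by_cases h : k - 1 ≤ 2 * b
    · exact n2 (inter b c (by omega) (by omega) hc hb)
    · exact n1 (inter b a (by omega) (by omega) ha hb).symm
  obtain ⟨x, y, z, hx, hy, hz, hxy, hxz, hyz⟩ := Finset.two_lt_card_iff.1 hc
  rw [Finset.mem_compl] at hx hy hz
  obtain ⟨a, ak, aB, rfl⟩ := key x hx
  obtain ⟨b, bk, bB, rfl⟩ := key y hy
  obtain ⟨c, ck, cB, rfl⟩ := key z hz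
  have ab : a ≠ b := by rintro rfl; exact hxy rfl
  have ac : a ≠ c := by rintro rfl; exact hxz rfl
  have bc : b ≠ c := by rintro rfl; exact hyz rfl
  rcases lt_or_gt_of_ne ab with h1 | h1 <;> rcases lt_or_gt_of_ne ac with h2 | h2 <;>
    rcases lt_or_gt_of_ne bc with h3 | h3
  · exact three a b c h1 h3 ck aB cB hy hxy hyz
  · exact three a c b h2 h3 bk aB bB hz hxz hyz.symm
  · omega
  · exact three c a b h2 h1 bk cB bB hx hxz.symm hxy
  · exact three b a c h1 h2 ck bB cB hx hxy.symm hxz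
  · omega
  · exact three b c a h3 h2 ak bB aB hz hyz hxz.symm
  · exact three c b a h3 h1 ak cB aB hy hyz.symm hxy.symm
end

section
/- Let p be a prime and let A, B be nonempty subsets of ℤ/pℤ with |B| ≥ 2, |A| ≥ 5, p ≥ |A| + |B|, and |A +̂ B| = |A| + |B| - 3. If A is a standard set, i.e., A = {τ + i·d : i = 0, 1, ..., |A| - 1} for some τ, d ∈ ℤ/pℤ with d ≠ 0, then A = B. -/
lemma aux_closed {p : ℕ} [Fact p.Prime] (C : Finset (ZMod p)) (hne : C.Nonempty)
    (h : ∀ x ∈ C, x + 1 ∈ C) (y : ZMod p) : y ∈ C := by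
  obtain ⟨x, hx⟩ := hne
  have key : ∀ n : ℕ, x + (n : ZMod p) ∈ C := by
    intro n
    induction n with
    | zero => simpa using hx
    | succ n ih =>
      have := h _ ih
      push_cast
      rwa [← add_assoc]
  have := key (y - x).val
  rw [ZMod.natCast_zmod_val] at this
  simpa using this

lemma aux_affine {p : ℕ} [Fact p.Prime] (A B : Finset (ZMod p)) (τ e : ZMod p) (he : e ≠ 0) :
    (restrictedSumsetZMod (A.image fun x => (x - τ) * e) (B.image fun x => (x - τ) * e)).card
      = (restrictedSumsetZMod A B).card := by
  have : restrictedSumsetZMod (A.image fun x => (x - τ) * e) (B.image fun x => (x - τ) * e)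
      = (restrictedSumsetZMod A B).image fun c => (c - 2 * τ) * e := by
    ext c
    simp only [restrictedSumsetZMod, Finset.mem_image, Finset.mem_filter, Finset.mem_product,
      Prod.exists]
    constructor
    · rintro ⟨_, _, ⟨⟨⟨a, ha, rfl⟩, ⟨b, hb, rfl⟩⟩, hab⟩, rfl⟩
      refine ⟨a + b, ⟨a, b, ⟨⟨ha, hb⟩, ?_⟩, rfl⟩, by ring⟩
      rintro rfl
      exact hab rfl
    · rintro ⟨_, ⟨a, b, ⟨⟨ha, hb⟩, hab⟩, rfl⟩, rfl⟩
      refine ⟨_, _, ⟨⟨⟨a, ha, rfl⟩, ⟨b, hb, rfl⟩⟩, ?_⟩, by ring⟩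
      intro h
      apply hab
      have := mul_right_cancel₀ he h
      simpa using this
  rw [this]
  apply Finset.card_image_of_injective
  intro x y h
  have := mul_right_cancel₀ he h
  simpa using this

lemma aux_cast {p : ℕ} {i j : ℕ} (hi : i < p) (hj : j < p)
    (h : (i : ZMod p) = (j : ZMod p)) : i = j := by
  rw [ZMod.natCast_eq_natCast_iff'] at h
  rwa [Nat.mod_eq_of_lt hi, Nat.mod_eq_of_lt hj] at h

open Pointwise in
lemma aux_main {p : ℕ} [Fact p.Prime] (k : ℕ) (B : Finset (ZMod p)) (hk : 5 ≤ k)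
    (hB : 2 ≤ B.card) (hpc : k + B.card ≤ p)
    (hcrit : (restrictedSumsetZMod ((Finset.range k).image fun i : ℕ => (i : ZMod p)) B).card
      = k + B.card - 3) :
    (Finset.range k).image (fun i : ℕ => (i : ZMod p)) = B := by
  have hp : p.Prime := Fact.out
  set A := (Finset.range k).image (fun i : ℕ => (i : ZMod p)) with hAdef
  have hmemA : ∀ x : ZMod p, x ∈ A ↔ ∃ i < k, (i : ZMod p) = x := by
    intro x; simp [hAdef]
  have hcardI : ∀ n ≤ k, ((Finset.range n).image (fun i : ℕ => (i : ZMod p))).card = n := by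
    intro n hn
    rw [Finset.card_image_of_injOn, Finset.card_range]
    intro i hi j hj h
    simp at hi hj
    exact aux_cast (by omega) (by omega) h
  have hAcard : A.card = k := hcardI k le_rfl
  have hBne : B.Nonempty := Finset.card_pos.mp (by omega)
  have hAne : A.Nonempty := Finset.card_pos.mp (by omega)
  have h2 : (2 : ZMod p) ≠ 0 := by
    intro h
    have : 2 = 0 := aux_cast (p := p) (by omega) (by omega) (by exact_mod_cast h)
    omega
  have hCD := ZMod.cauchy_davenport hp hAne hBne
  rw [hAcard] at hCD
  set S := restrictedSumsetZMod A B with hS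
  have hmemS : ∀ a ∈ A, ∀ b ∈ B, a ≠ b → a + b ∈ S := by
    intro a ha b hb hab
    simp only [hS, restrictedSumsetZMod, Finset.mem_image, Finset.mem_filter, Finset.mem_product,
      Prod.exists]
    exact ⟨a, b, ⟨⟨ha, hb⟩, hab⟩, rfl⟩
  classical
  let L := (Finset.range k).filter fun i : ℕ => (i : ZMod p) ∈ B ∧
    ∀ j < k, (2 * (i : ZMod p) - j) ∈ B → j = i
  have hLmem : ∀ i, i ∈ L ↔ i < k ∧ (i : ZMod p) ∈ B ∧
      ∀ j < k, (2 * (i : ZMod p) - j) ∈ B → j = i := by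
    intro i; simp [L]
  have hsub : (A + B) \ S ⊆ L.image fun i : ℕ => 2 * (i : ZMod p) := by
    intro c hc
    rw [Finset.mem_sdiff, Finset.mem_add] at hc
    obtain ⟨⟨a, ha, b, hb, rfl⟩, hcS⟩ := hc
    have hab : a = b := by
      by_contra h
      exact hcS (hmemS a ha b hb h)
    subst hab
    obtain ⟨i, hi, rfl⟩ := (hmemA a).1 ha
    rw [Finset.mem_image]
    refine ⟨i, (hLmem i).2 ⟨hi, hb, ?_⟩, by ring⟩
    intro j hj hjB
    have h1 : (j : ZMod p) = 2 * (i : ZMod p) - j := by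
      by_contra h
      have := hmemS _ ((hmemA _).2 ⟨j, hj, rfl⟩) _ hjB h
      apply hcS
      convert this using 1
      ring
    have h3 : (2 : ZMod p) * j = 2 * i := by linear_combination h1
    exact aux_cast (by omega) (by omega) (mul_left_cancel₀ h2 h3)
  have hpair : ∀ i ∈ L, ∀ i' ∈ L, i < i' → 2 * i < i' ∧ k + i ≤ 2 * i' := by
    intro i hi i' hi' hlt
    obtain ⟨a1, a2, a3⟩ := (hLmem _).1 hi
    obtain ⟨b1, b2, b3⟩ := (hLmem _).1 hi'
    constructor
    · by_contra h
      have := a3 (2 * i - i') (by omega) (by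
        rw [Nat.cast_sub (by omega)]; push_cast; simpa using b2)
      omega
    · by_contra h
      have := b3 (2 * i' - i) (by omega) (by
        rw [Nat.cast_sub (by omega)]; push_cast; simpa using a2)
      omega
  have hL2 : L.card ≤ 2 := by
    by_contra h
    obtain ⟨a, b, c, ha, hb, hc, hab, hac, hbc⟩ := Finset.two_lt_card_iff.1 (not_le.1 h)
    have := ((hLmem _).1 ha).1
    have := ((hLmem _).1 hb).1
    have := ((hLmem _).1 hc).1
    have := hpair a ha b hb
    have := hpair b hb a ha
    have := hpair a ha c hc
    have := hpair c hc a ha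
    have := hpair b hb c hc
    have := hpair c hc b hb
    omega
  have hc1 : ((A + B) \ S).card ≤ L.card := (Finset.card_le_card hsub).trans Finset.card_image_le
  have hc2 := Finset.le_card_sdiff S (A + B)
  have hCD' : k + B.card - 1 ≤ (A + B).card := by
    refine le_trans ?_ hCD
    rw [le_min_iff]; omega
  have hABcard : (A + B).card = k + B.card - 1 := by omega
  have hLcard : 1 < L.card := by omega
  -- B + {0,1}
  have hBB : (B + {0, 1}).card ≤ B.card + 1 := by
    let A' := (Finset.range (k-1)).image (fun i : ℕ => (i : ZMod p))
    have hA' : A'.card = k - 1 := hcardI _ (by omega)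
    have hne : A'.Nonempty := Finset.card_pos.mp (by omega)
    have hne2 : (B + {0, 1}).Nonempty := hBne.add (by simp)
    have h3 := ZMod.cauchy_davenport hp hne hne2
    have h4 : A' + (B + {0, 1}) ⊆ A + B := by
      intro x hx
      simp only [Finset.mem_add] at hx
      obtain ⟨a, ha, _, ⟨b, hb, u, hu, rfl⟩, rfl⟩ := hx
      obtain ⟨i, hi, rfl⟩ := Finset.mem_image.1 ha
      simp only [Finset.mem_range] at hi
      simp only [Finset.mem_insert, Finset.mem_singleton] at hu
      rw [Finset.mem_add]
      rcases hu with rfl | rfl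
      · exact ⟨i, (hmemA _).2 ⟨i, by omega, rfl⟩, b, hb, by ring⟩
      · exact ⟨(i + 1 : ℕ), (hmemA _).2 ⟨i + 1, by omega, rfl⟩, b, hb, by push_cast; ring⟩
    have h5 := Finset.card_le_card h4
    rw [hA'] at h3
    rw [min_le_iff] at h3
    omega
  have hend : ∀ x ∈ B, ∀ y ∈ B, x + 1 ∉ B → y + 1 ∉ B → x = y := by
    intro x hx y hy hx1 hy1
    by_contra hxy
    have hs : insert (x + 1) (insert (y + 1) B) ⊆ B + {0, 1} := by
      intro z hz
      simp only [Finset.mem_insert] at hz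
      rw [Finset.mem_add]
      rcases hz with rfl | rfl | hz
      · exact ⟨x, hx, 1, by simp, rfl⟩
      · exact ⟨y, hy, 1, by simp, rfl⟩
      · exact ⟨z, hz, 0, by simp, by simp⟩
    have := Finset.card_le_card hs
    rw [Finset.card_insert_of_notMem, Finset.card_insert_of_notMem hy1] at this
    · omega
    · simp [hx1, hxy]
  have hstart : ∀ x ∈ B, ∀ y ∈ B, x - 1 ∉ B → y - 1 ∉ B → x = y := by
    intro x hx y hy hx1 hy1
    by_contra hxy
    have hs : insert x (insert y (B.image (· + 1))) ⊆ B + {0, 1} := by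
      intro z hz
      simp only [Finset.mem_insert, Finset.mem_image] at hz
      rw [Finset.mem_add]
      rcases hz with rfl | rfl | ⟨w, hw, rfl⟩
      · exact ⟨z, hx, 0, by simp, by simp⟩
      · exact ⟨z, hy, 0, by simp, by simp⟩
      · exact ⟨w, hw, 1, by simp, rfl⟩
    have hn : ∀ z, z - 1 ∉ B → z ∉ B.image (· + 1) := by
      intro z hz h
      obtain ⟨w, hw, rfl⟩ := Finset.mem_image.1 h
      simp at hz
      exact hz hw
    have := Finset.card_le_card hs
    rw [Finset.card_insert_of_notMem, Finset.card_insert_of_notMem (hn y hy1),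
      Finset.card_image_of_injective _ (add_left_injective 1)] at this
    · omega
    · rw [Finset.mem_insert, not_or]
      exact ⟨hxy, hn x hx1⟩
  have hnotuniv : ∀ C : Finset (ZMod p), C.card < p → ¬ ∀ y, y ∈ C := by
    intro C hC h
    have : C = Finset.univ := by ext; simp [h]
    rw [this, Finset.card_univ, ZMod.card] at hC
    omega
  have hLR : ∀ i ∈ L, 1 ≤ i → (i : ZMod p) + 1 ∉ B := by
    intro i hi h1 hB1
    obtain ⟨a1, a2, a3⟩ := (hLmem _).1 hi
    have := a3 (i - 1) (by omega) (by
      rw [Nat.cast_sub h1]; convert hB1 using 1; push_cast; ring)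
    omega
  have hLL : ∀ i ∈ L, i + 1 < k → (i : ZMod p) - 1 ∉ B := by
    intro i hi h1 hB1
    obtain ⟨a1, a2, a3⟩ := (hLmem _).1 hi
    have := a3 (i + 1) h1 (by
      convert hB1 using 1; push_cast; ring)
    omega
  have hmid : ∀ i ∈ L, i = 0 ∨ i = k - 1 := by
    intro i hi
    obtain ⟨a1, a2, a3⟩ := (hLmem _).1 hi
    by_contra hcon
    have r1 := hLR i hi (by omega)
    have r2 := hLL i hi (by omega)
    have hce := Finset.card_erase_of_mem a2
    apply hnotuniv (B.erase (i : ZMod p)) (by omega)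
    apply aux_closed
    · exact Finset.card_pos.mp (by omega)
    · intro x hx
      rw [Finset.mem_erase] at hx ⊢
      refine ⟨?_, ?_⟩
      · intro h
        apply r2
        rw [← h]; simpa using hx.2
      · by_contra h
        exact hx.1 (hend x hx.2 _ a2 h r1)
  obtain ⟨u, v, hu, hv, huv⟩ := Finset.one_lt_card_iff.1 hLcard
  have h0k : 0 ∈ L ∧ k - 1 ∈ L := by
    rcases hmid u hu with h | h <;> rcases hmid v hv with h' | h' <;> subst h <;> subst h' <;>
      first | exact absurd rfl huv | exact ⟨hu, hv⟩ | exact ⟨hv, hu⟩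
  obtain ⟨h0, hk1⟩ := h0k
  have e1 := hLL 0 h0 (by omega)
  have e2 := hLR (k - 1) hk1 (by omega)
  have m1 := ((hLmem _).1 h0).2.1
  have m2 := ((hLmem _).1 hk1).2.1
  rw [Nat.cast_zero] at e1 m1
  apply Finset.Subset.antisymm
  · rw [← Finset.sdiff_eq_empty_iff_subset]
    by_contra hne
    apply hnotuniv (A \ B) (by have := Finset.card_le_card (Finset.sdiff_subset (s := A) (t := B)); omega)
    apply aux_closed _ (Finset.nonempty_iff_ne_empty.2 hne)
    intro x hx
    rw [Finset.mem_sdiff] at hx ⊢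
    obtain ⟨i, hi, rfl⟩ := (hmemA _).1 hx.1
    have hik : i ≠ k - 1 := by rintro rfl; exact hx.2 m2
    refine ⟨(hmemA _).2 ⟨i + 1, by omega, by push_cast; ring⟩, ?_⟩
    intro h
    have h' := hstart _ h _ m1 (by simpa using hx.2) e1
    have : i + 1 = 0 := aux_cast (p := p) (by omega) (by omega) (by push_cast; exact h')
    omega
  · rw [← Finset.sdiff_eq_empty_iff_subset]
    by_contra hne
    apply hnotuniv (B \ A) (by have := Finset.card_le_card (Finset.sdiff_subset (s := B) (t := A)); omega)
    apply aux_closed _ (Finset.nonempty_iff_ne_empty.2 hne)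
    intro x hx
    rw [Finset.mem_sdiff] at hx ⊢
    constructor
    · by_contra h
      have := hend x hx.1 _ m2 h e2
      exact hx.2 ((hmemA _).2 ⟨k - 1, by omega, this.symm⟩)
    · intro h
      obtain ⟨i, hi, hix⟩ := (hmemA _).1 h
      rcases Nat.eq_zero_or_pos i with rfl | hpos
      · apply e1
        rw [Nat.cast_zero] at hix
        rw [hix]; simpa using hx.1
      · apply hx.2
        refine (hmemA _).2 ⟨i - 1, by omega, ?_⟩
        rw [Nat.cast_sub hpos, hix]; push_cast; ring

theorem stmt_13 (p : ℕ) (hp : p.Prime) (A B : Finset (ZMod p))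
    (hB : 2 ≤ B.card) (hA : 5 ≤ A.card)
    (hpcard : A.card + B.card ≤ p)
    (hcrit : (restrictedSumsetZMod A B).card = A.card + B.card - 3)
    (hstd : ∃ τ d : ZMod p, d ≠ 0 ∧
      A = (Finset.range A.card).image fun i : ℕ => τ + (i : ZMod p) * d) :
    A = B := by
  haveI : Fact p.Prime := ⟨hp⟩
  obtain ⟨τ, d, hd, hAeq⟩ := hstd
  have hinj : Function.Injective (fun x : ZMod p => (x - τ) * d⁻¹) := by
    intro x y h
    have := mul_right_cancel₀ (inv_ne_zero hd) h
    simpa using this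
  have hAi : A.image (fun x : ZMod p => (x - τ) * d⁻¹)
      = (Finset.range A.card).image fun i : ℕ => (i : ZMod p) := by
    conv_lhs => rw [hAeq]
    rw [Finset.image_image]
    apply Finset.image_congr
    intro i _
    simp [hd]
  have hBc := Finset.card_image_of_injective B hinj
  have haff := aux_affine A B τ d⁻¹ (inv_ne_zero hd)
  rw [hAi, hcrit] at haff
  have := aux_main A.card (B.image fun x : ZMod p => (x - τ) * d⁻¹) hA (by omega) (by omega)
    (by rw [haff, hBc])
  rw [← hAi] at this
  exact Finset.image_injective hinj this
end

section
/- Let p be a prime and let A, B be nonempty subsets of ℤ/pℤ with |B| ≥ 2, |A| ≥ 5, p ≥ |A| + |B|, and |A +̂ B| = |A| + |B| - 3. If A = {τ + i·d : i = 0, 1, ..., |A| - 1} for some τ, d ∈ ℤ/pℤ with d ≠ 0, then B is an arithmetic progression with the same common difference d: there exists b ∈ ℤ/pℤ such that B = {b + t·d : t = 0, 1, ..., |B| - 1}. -/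
theorem stmt_14 (p : ℕ) (hp : p.Prime) (A B : Finset (ZMod p))
    (hB : 2 ≤ B.card) (hA : 5 ≤ A.card)
    (hpcard : A.card + B.card ≤ p)
    (hcrit : (restrictedSumsetZMod A B).card = A.card + B.card - 3)
    (τ d : ZMod p) (hd : d ≠ 0)
    (hAform : A = (Finset.range A.card).image fun i : ℕ => τ + (i : ZMod p) * d) :
    ∃ b : ZMod p, B = (Finset.range B.card).image fun t : ℕ => b + (t : ZMod p) * d := by
  have : Fact p.Prime := ⟨hp⟩
  have hAm : ∀ a, a ∈ A ↔ ∃ i : ℕ, i < A.card ∧ τ + (i : ZMod p) * d = a := by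
    intro a
    constructor
    · intro h
      rw [hAform] at h
      simpa using h
    · rintro ⟨i, hi, rfl⟩
      rw [hAform]
      exact Finset.mem_image.2 ⟨i, Finset.mem_range.2 hi, rfl⟩
  obtain ⟨k, hk⟩ : ∃ k, k = A.card := ⟨_, rfl⟩
  obtain ⟨l, hl⟩ : ∃ l, l = B.card := ⟨_, rfl⟩
  rw [← hk] at hA hpcard hcrit hAm
  rw [← hl] at hB hpcard hcrit ⊢
  have h2 : (2 : ZMod p) ≠ 0 := by
    intro h
    have h' : ((2 : ℕ) : ZMod p) = 0 := by exact_mod_cast h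
    rw [ZMod.natCast_eq_zero_iff] at h'
    have := Nat.le_of_dvd (by norm_num) h'
    omega
  have hinj : ∀ m n : ℕ, m < p → n < p → (m : ZMod p) = n → m = n := by
    intro m n hm hn h
    rw [ZMod.natCast_eq_natCast_iff'] at h
    rwa [Nat.mod_eq_of_lt hm, Nat.mod_eq_of_lt hn] at h
  set R := restrictedSumsetZMod A B with hR
  have hRm : ∀ a ∈ A, ∀ b ∈ B, a ≠ b → a + b ∈ R := by
    intro a ha b hb hab
    exact Finset.mem_image.2 ⟨(a, b), by simp [ha, hb, hab], rfl⟩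
  set T := (A ×ˢ B).image (fun q => q.1 + q.2) with hT
  have hTm : ∀ a ∈ A, ∀ b ∈ B, a + b ∈ T := by
    intro a ha b hb
    exact Finset.mem_image.2 ⟨(a, b), by simp [ha, hb], rfl⟩
  have hmiss : ∀ t ∈ T \ R, ∃ i : ℕ, i < k ∧ τ + (i : ZMod p) * d ∈ B ∧
      t = (τ + (i : ZMod p) * d) + (τ + (i : ZMod p) * d) := by
    intro t ht
    rw [Finset.mem_sdiff] at ht
    obtain ⟨ht, hn⟩ := ht
    obtain ⟨⟨a, b⟩, hq, rfl⟩ := Finset.mem_image.1 ht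
    rw [Finset.mem_product] at hq
    simp only at hq hn
    by_cases hab : a = b
    · subst hab
      obtain ⟨i, hi, rfl⟩ := (hAm a).1 hq.1
      exact ⟨i, hi, hq.2, rfl⟩
    · exact absurd (hRm a hq.1 b hq.2 hab) hn
  have hpair : ∀ i j : ℕ, i < k → j < k → i ≠ j → τ + (j : ZMod p) * d ∈ B →
      (τ + (i : ZMod p) * d) + (τ + (i : ZMod p) * d) ∉ R → 2 * i < j ∨ j + k ≤ 2 * i := by
    intro i j hi hj hij hjB hiR
    by_contra hcon
    push Not at hcon
    obtain ⟨c, hc⟩ : ∃ c, 2 * i = c + j := ⟨2 * i - j, by omega⟩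
    have hck : c < k := by omega
    have hcz : (2 : ZMod p) * i = c + j := by exact_mod_cast congrArg (Nat.cast (R := ZMod p)) hc
    apply hiR
    have : (τ + (i : ZMod p) * d) + (τ + (i : ZMod p) * d)
        = (τ + (c : ZMod p) * d) + (τ + (j : ZMod p) * d) := by
      linear_combination d * hcz
    rw [this]
    apply hRm _ ((hAm _).2 ⟨c, hck, rfl⟩) _ hjB
    intro h
    have h3 := mul_right_cancel₀ hd (add_left_cancel h)
    have h4 := hinj c j (by omega) (by omega) h3
    omega
  have hcard2 : (T \ R).card ≤ 2 := by
    by_contra hcon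
    push Not at hcon
    obtain ⟨t1, t2, t3, h1, h2, h3, h12, h13, h23⟩ := Finset.two_lt_card_iff.1 hcon
    obtain ⟨i1, a1, b1, c1⟩ := hmiss t1 h1
    obtain ⟨i2, a2, b2, c2⟩ := hmiss t2 h2
    obtain ⟨i3, a3, b3, c3⟩ := hmiss t3 h3
    have n1 := (Finset.mem_sdiff.1 h1).2
    have n2 := (Finset.mem_sdiff.1 h2).2
    have n3 := (Finset.mem_sdiff.1 h3).2
    rw [c1] at n1
    rw [c2] at n2
    rw [c3] at n3
    have e12 : i1 ≠ i2 := by rintro rfl; exact h12 (c1.trans c2.symm)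
    have e13 : i1 ≠ i3 := by rintro rfl; exact h13 (c1.trans c3.symm)
    have e23 : i2 ≠ i3 := by rintro rfl; exact h23 (c2.trans c3.symm)
    have := hpair i1 i2 a1 a2 e12 b2 n1
    have := hpair i2 i1 a2 a1 e12.symm b1 n2
    have := hpair i1 i3 a1 a3 e13 b3 n1
    have := hpair i3 i1 a3 a1 e13.symm b1 n3
    have := hpair i2 i3 a2 a3 e23 b3 n2
    have := hpair i3 i2 a3 a2 e23.symm b2 n3
    omega
  have hTcard : T.card ≤ k + l - 1 := by
    have : T.card ≤ (T \ R).card + R.card := Finset.card_le_card_sdiff_add_card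
    omega
  obtain ⟨x, hx⟩ : ∃ x, x ∉ T := by
    by_contra hcon
    push Not at hcon
    have : T = Finset.univ := Finset.eq_univ_iff_forall.2 hcon
    rw [this, Finset.card_univ, ZMod.card] at hTcard
    omega
  set f : ZMod p → ℕ := fun b => ((b - (x - τ)) * d⁻¹).val with hf
  have hfb : ∀ b, b = (x - τ) + (f b : ZMod p) * d := by
    intro b
    simp only [hf, ZMod.natCast_zmod_val]
    field_simp
    ring
  have hflt : ∀ b, f b < p := fun b => ZMod.val_lt _
  have hfB : ∀ b ∈ B, 1 ≤ f b ∧ f b + k ≤ p := by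
    intro b hb
    have h0 : ∀ i : ℕ, i < k → f b + i ≠ p ∧ f b + i ≠ 0 := by
      intro i hi
      have key : ((f b + i : ℕ) : ZMod p) ≠ 0 := by
        intro h
        apply hx
        have := hTm _ ((hAm _).2 ⟨i, hi, rfl⟩) b hb
        convert this using 1
        push_cast at h
        linear_combination - hfb b - d * h
      constructor
      · intro h; rw [h] at key; simp at key
      · intro h; rw [h] at key; simp at key
    have := hflt b
    constructor
    · have := (h0 0 (by omega)).2
      omega
    · by_contra hcon
      exact (h0 (p - f b) (by omega)).1 (by omega)
  set B' := B.image f with hB'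
  have hB'card : B'.card = l := by
    rw [hl]
    apply Finset.card_image_of_injective
    intro a b hab
    rw [hfb a, hfb b, hab]
  have hB'ne : B'.Nonempty := Finset.card_pos.1 (by omega)
  have hB'b : ∀ n ∈ B', 1 ≤ n ∧ n + k ≤ p := by
    intro n hn
    obtain ⟨b, hb, rfl⟩ := Finset.mem_image.1 hn
    exact hfB b hb
  set g : ℕ → ZMod p := fun n => x + (n : ZMod p) * d with hg
  have hgT : ∀ n ∈ B', ∀ i < k, g (n + i) ∈ T := by
    intro n hn i hi
    obtain ⟨b, hb, rfl⟩ := Finset.mem_image.1 hn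
    have := hTm _ ((hAm _).2 ⟨i, hi, rfl⟩) b hb
    convert this using 1
    simp only [hg]
    push_cast
    linear_combination - hfb b
  have hginj : ∀ m n : ℕ, m < p → n < p → g m = g n → m = n := by
    intro m n hm hn h
    exact hinj m n hm hn (mul_right_cancel₀ hd (add_left_cancel h))
  obtain ⟨M, hMm, hMmax⟩ : ∃ M ∈ B', ∀ n ∈ B', n ≤ M :=
    ⟨B'.max' hB'ne, B'.max'_mem _, fun n hn => B'.le_max' n hn⟩
  obtain ⟨m, hmm, hmmin⟩ : ∃ m ∈ B', ∀ n ∈ B', m ≤ n :=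
    ⟨B'.min' hB'ne, B'.min'_mem _, fun n hn => B'.min'_le n hn⟩
  have hMp := hB'b M hMm
  set U := B' ∪ Finset.Ioc M (M + k - 1) with hU
  have hUp : ∀ n ∈ U, n < p := by
    intro n hn
    rcases Finset.mem_union.1 hn with h | h
    · have := hB'b n h
      omega
    · have := Finset.mem_Ioc.1 h
      omega
  have hUcard : U.card = l + (k - 1) := by
    rw [hU, Finset.card_union_of_disjoint, hB'card, Nat.card_Ioc]
    · omega
    · rw [Finset.disjoint_left]
      intro n hn h
      have := hMmax n hn
      have := Finset.mem_Ioc.1 h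
      omega
  have hUT : U.image g = T := by
    apply Finset.eq_of_subset_of_card_le
    · intro y hy
      obtain ⟨n, hn, rfl⟩ := Finset.mem_image.1 hy
      rcases Finset.mem_union.1 hn with h | h
      · exact hgT n h 0 (by omega)
      · have := Finset.mem_Ioc.1 h
        have h' := hgT M hMm (n - M) (by omega)
        rwa [show M + (n - M) = n by omega] at h'
    · rw [Finset.card_image_of_injOn (s := U) (f := g), hUcard]
      · omega
      · intro a ha b hb hab
        exact hginj a b (hUp a ha) (hUp b hb) hab
  have hstep : ∀ n ∈ B', n < M → n + 1 ∈ B' := by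
    intro n hn hnM
    have h1 := hgT n hn 1 (by omega)
    rw [← hUT] at h1
    obtain ⟨u, hu, hgu⟩ := Finset.mem_image.1 h1
    have := hginj u (n + 1) (hUp u hu) (by omega) hgu
    subst this
    rcases Finset.mem_union.1 hu with h | h
    · exact h
    · have := Finset.mem_Ioc.1 h
      omega
  have hint : ∀ t, m + t ≤ M → m + t ∈ B' := by
    intro t
    induction t with
    | zero => intro _; exact hmm
    | succ t ih =>
      intro h
      exact hstep (m + t) (ih (by omega)) (by omega)
  have hIcc : B' = Finset.Icc m M := by
    ext n
    rw [Finset.mem_Icc]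
    constructor
    · intro h
      exact ⟨hmmin n h, hMmax n h⟩
    · rintro ⟨h1, h2⟩
      have := hint (n - m) (by omega)
      rwa [show m + (n - m) = n by omega] at this
  have hlM : M + 1 - m = l := by
    rw [← hB'card, hIcc, Nat.card_Icc]
  refine ⟨(x - τ) + (m : ZMod p) * d, ?_⟩
  apply Finset.eq_of_subset_of_card_le
  · intro b hb
    have h1 : f b ∈ B' := Finset.mem_image_of_mem f hb
    rw [hIcc, Finset.mem_Icc] at h1
    refine Finset.mem_image.2 ⟨f b - m, Finset.mem_range.2 (by omega), ?_⟩
    have h3 := hfb b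
    rw [Nat.cast_sub h1.1]
    linear_combination - h3
  · refine Finset.card_image_le.trans ?_
    rw [Finset.card_range, hl]
end
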